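/- (First half of Lemma 3.1) Let Ξ : V₊ → ℂ be smooth with □Ξ = 0 on V₊, let B ⊆ V₊ be compact, and let ε > 0. Then there exist finitely many multi-indices 𝛍 = (μ₁, …, μ_m) with μ_i ∈ {0,1,2,3} and m even, and complex constants c_𝛍, such that sup_{β ∈ B} | Ξ(β) − Σ_𝛍 c_𝛍 ∂_{μ₁}⋯∂_{μ_m} (β·β)⁻¹ | < ε. That is, the linear span of the iterated partial derivatives of even order of the function β ↦ (β·β)⁻¹ is dense, with respect to uniform convergence on compact subsets of V₊, in the space of smooth solutions of the wave equation on V₊. -/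

import Mathlib

noncomputable section

/-- Minkowski inner product on ℝ⁴: x·y = x₀y₀ − x₁y₁ − x₂y₂ − x₃y₃. -/
def mink (x y : Fin 4 → ℝ) : ℝ := x 0 * y 0 - x 1 * y 1 - x 2 * y 2 - x 3 * y 3

/-- Partial derivative in the ν-th coordinate direction. -/
def pd {E : Type*} [NormedAddCommGroup E] [NormedSpace ℝ E]
    (ν : Fin 4) (f : (Fin 4 → ℝ) → E) (x : Fin 4 → ℝ) : E :=
  fderiv ℝ f x (Pi.single ν 1)

/-- Iterated partial derivative ∂_{μ₁}⋯∂_{μ_m} along a multi-index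
𝛍 = (μ₁, …, μ_m). -/
def pdIter : List (Fin 4) → ((Fin 4 → ℝ) → ℝ) → ((Fin 4 → ℝ) → ℝ)
  | [], f => f
  | ν :: μ, f => pd ν (pdIter μ f)

/-- The d'Alembertian □ = ∂₀² − ∂₁² − ∂₂² − ∂₃². -/
def box {E : Type*} [NormedAddCommGroup E] [NormedSpace ℝ E]
    (f : (Fin 4 → ℝ) → E) (x : Fin 4 → ℝ) : E :=
  pd 0 (pd 0 f) x - pd 1 (pd 1 f) x - pd 2 (pd 2 f) x - pd 3 (pd 3 f) x

/-- The open forward light cone V₊ = {x : x₀ > 0, x·x > 0}. -/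
def Vplus : Set (Fin 4 → ℝ) := {x | 0 < x 0 ∧ 0 < mink x x}

section

open Set Filter Topology MeasureTheory
open scoped ContDiff Pointwise

/-- The spatial part of a point of Minkowski space, as a Euclidean vector. -/
def spatial : (Fin 4 → ℝ) →L[ℝ] EuclideanSpace ℝ (Fin 3) :=
  LinearMap.toContinuousLinearMap
    { toFun := fun p => WithLp.toLp 2 fun i => p i.succ
      map_add' := fun p q => by ext i; simp
      map_smul' := fun a p => by ext i; simp }

@[simp] lemma spatial_apply (p : Fin 4 → ℝ) (i : Fin 3) : spatial p i = p i.succ := rfl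

lemma norm_spatial_sq (p : Fin 4 → ℝ) : ‖spatial p‖ ^ 2 = p 1 ^ 2 + p 2 ^ 2 + p 3 ^ 2 := by
  rw [EuclideanSpace.real_norm_sq_eq, Fin.sum_univ_three]
  rfl

lemma mink_self_eq (p : Fin 4 → ℝ) : mink p p = p 0 ^ 2 - ‖spatial p‖ ^ 2 := by
  rw [norm_spatial_sq, mink]; ring

lemma mem_Vplus_iff (p : Fin 4 → ℝ) : p ∈ Vplus ↔ ‖spatial p‖ < p 0 := by
  have h := norm_nonneg (spatial p)
  simp only [Vplus, mem_ofPred_eq, mink_self_eq]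
  constructor
  · rintro ⟨h0, h1⟩
    nlinarith
  · intro h1
    exact ⟨by linarith, by nlinarith⟩

lemma isOpen_Vplus : IsOpen Vplus := by
  have : Vplus = {p | ‖spatial p‖ < p 0} := by ext p; exact mem_Vplus_iff p
  rw [this]
  exact isOpen_lt (by fun_prop) (by fun_prop)

lemma mink_eq_sub_inner (x y : Fin 4 → ℝ) :
    mink x y = x 0 * y 0 - inner ℝ (spatial x) (spatial y) := by
  simp only [mink, PiLp.inner_apply, Fin.sum_univ_three, spatial_apply, Real.inner_apply]
  simp only [Fin.succ_zero_eq_one, Fin.succ_one_eq_two, show (2 : Fin 3).succ = 3 from rfl]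
  ring

lemma mink_pos {x y : Fin 4 → ℝ} (hx : x ∈ Vplus) (hy : y ∈ Vplus) : 0 < mink x y := by
  rw [mem_Vplus_iff] at hx hy
  rw [mink_eq_sub_inner]
  have h := real_inner_le_norm (spatial x) (spatial y)
  have := mul_lt_mul'' hx hy (norm_nonneg _) (norm_nonneg _)
  linarith

lemma mink_add_smul_self (x e : Fin 4 → ℝ) (s : ℝ) :
    mink (x + s • e) (x + s • e) = mink x x + 2 * s * mink x e + s ^ 2 * mink e e := by
  simp only [mink, Pi.add_apply, Pi.smul_apply, smul_eq_mul]; ring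

lemma contDiff_mink_self : ContDiff ℝ ∞ (fun x : Fin 4 → ℝ => mink x x) := by
  unfold mink; fun_prop

lemma continuous_mink_left (e : Fin 4 → ℝ) : Continuous (fun x : Fin 4 → ℝ => mink x e) := by
  unfold mink; fun_prop

/-- The function `β ↦ (β·β)⁻¹`. -/
def invSq (β : Fin 4 → ℝ) : ℝ := (mink β β)⁻¹

lemma contDiffOn_invSq : ContDiffOn ℝ ∞ invSq Vplus :=
  contDiff_mink_self.contDiffOn.inv fun _ hx => hx.2.ne'

lemma ContDiffOn.fderiv_apply_of_isOpen {E F : Type*} [NormedAddCommGroup E] [NormedSpace ℝ E]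
    [NormedAddCommGroup F] [NormedSpace ℝ F] {f : E → F} {s : Set E}
    (hf : ContDiffOn ℝ ∞ f s) (hs : IsOpen s) (v : E) :
    ContDiffOn ℝ ∞ (fun x => fderiv ℝ f x v) s :=
  (hf.fderiv_of_isOpen hs (m := ∞) (by simp)).clm_apply contDiffOn_const

lemma contDiffOn_pdIter (μ : List (Fin 4)) : ContDiffOn ℝ ∞ (pdIter μ invSq) Vplus := by
  induction μ with
  | nil => exact contDiffOn_invSq
  | cons ν μ ih => exact ih.fderiv_apply_of_isOpen isOpen_Vplus _

lemma fderiv_eq_sum_pd {E : Type*} [NormedAddCommGroup E] [NormedSpace ℝ E]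
    (f : (Fin 4 → ℝ) → E) (x e : Fin 4 → ℝ) : fderiv ℝ f x e = ∑ ν, e ν • pd ν f x := by
  conv_lhs => rw [← Finset.univ_sum_single e]
  rw [map_sum]
  refine Finset.sum_congr rfl fun ν _ => ?_
  rw [pd, ← map_smul, ← Pi.single_smul, smul_eq_mul, mul_one]

/-- The iterated directional derivatives of `invSq`. -/
def dirIter (e : Fin 4 → ℝ) : ℕ → (Fin 4 → ℝ) → ℝ
  | 0 => invSq
  | n + 1 => fun x => fderiv ℝ (dirIter e n) x e

lemma contDiffOn_dirIter (e : Fin 4 → ℝ) (n : ℕ) : ContDiffOn ℝ ∞ (dirIter e n) Vplus := by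
  induction n with
  | zero => exact contDiffOn_invSq
  | succ n ih => exact ih.fderiv_apply_of_isOpen isOpen_Vplus e

/-- The span of the iterated partial derivatives of order `n` of `invSq`. -/
def derivSpan (n : ℕ) : Submodule ℝ ((Fin 4 → ℝ) → ℝ) :=
  Submodule.span ℝ ((fun μ => pdIter μ invSq) '' {μ | μ.length = n})

lemma exists_mem_derivSpan_succ (e : Fin 4 → ℝ) {n : ℕ} {ψ : (Fin 4 → ℝ) → ℝ}
    (hψ : ψ ∈ derivSpan n) :
    ContDiffOn ℝ ∞ ψ Vplus ∧
      ∃ χ ∈ derivSpan (n + 1), EqOn (fun x => fderiv ℝ ψ x e) χ Vplus := by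
  induction hψ using Submodule.span_induction with
  | mem ψ h =>
    obtain ⟨μ, hμ, rfl⟩ := h
    refine ⟨contDiffOn_pdIter μ, ∑ ν, e ν • pdIter (ν :: μ) invSq,
      Submodule.sum_mem _ fun ν _ => Submodule.smul_mem _ _ (Submodule.subset_span
        ⟨ν :: μ, by simpa using hμ, rfl⟩), fun x _ => ?_⟩
    simp only [fderiv_eq_sum_pd, Finset.sum_apply, Pi.smul_apply, pdIter]
  | zero =>
    refine ⟨contDiffOn_const, 0, zero_mem _, fun x _ => ?_⟩
    simp
  | add ψ₁ ψ₂ _ _ h₁ h₂ =>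
    obtain ⟨c₁, χ₁, m₁, e₁⟩ := h₁
    obtain ⟨c₂, χ₂, m₂, e₂⟩ := h₂
    refine ⟨c₁.add c₂, χ₁ + χ₂, add_mem m₁ m₂, fun x hx => ?_⟩
    have hd₁ := (c₁.contDiffAt (isOpen_Vplus.mem_nhds hx)).differentiableAt (by simp)
    have hd₂ := (c₂.contDiffAt (isOpen_Vplus.mem_nhds hx)).differentiableAt (by simp)
    have := e₁ hx
    have := e₂ hx
    simp_all [fderiv_add]
  | smul a ψ _ h =>
    obtain ⟨c, χ, m, e'⟩ := h
    refine ⟨contDiffOn_const.smul c, a • χ, Submodule.smul_mem _ _ m, fun x hx => ?_⟩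
    have hd := (c.contDiffAt (isOpen_Vplus.mem_nhds hx)).differentiableAt (by simp)
    have := e' hx
    simp_all [fderiv_const_smul]

lemma exists_mem_derivSpan_eqOn_dirIter (e : Fin 4 → ℝ) (n : ℕ) :
    ∃ χ ∈ derivSpan n, EqOn (dirIter e n) χ Vplus := by
  induction n with
  | zero => exact ⟨invSq, Submodule.subset_span ⟨[], rfl, rfl⟩, fun _ _ => rfl⟩
  | succ n ih =>
    obtain ⟨χ, hχ, h⟩ := ih
    obtain ⟨-, χ', hχ', h'⟩ := exists_mem_derivSpan_succ e hχ
    refine ⟨χ', hχ', fun x hx => ?_⟩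
    rw [← h' hx]
    simp only [dirIter]
    rw [(h.eventuallyEq_of_mem (isOpen_Vplus.mem_nhds hx)).fderiv_eq]

lemma hasDerivAt_dirIter (e : Fin 4 → ℝ) (n : ℕ) (x : Fin 4 → ℝ) (s : ℝ)
    (hx : x + s • e ∈ Vplus) :
    HasDerivAt (fun s : ℝ => dirIter e n (x + s • e)) (dirIter e (n + 1) (x + s • e)) s := by
  have h1 := ((contDiffOn_dirIter e n).contDiffAt (isOpen_Vplus.mem_nhds hx)).differentiableAt
    (by simp)
  have h2 : HasDerivAt (fun s : ℝ => x + s • e) e s := by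
    simpa using ((hasDerivAt_id s).smul_const e).const_add x
  exact h1.hasFDerivAt.comp_hasDerivAt s h2

/-- A continuous functional on `C(B, ℂ)` which annihilates all even-order derivatives. -/
def AnnihilatesEven {B : Set (Fin 4 → ℝ)} [CompactSpace B] (L : C(B, ℂ) →L[ℂ] ℂ) : Prop :=
  ∀ μ : List (Fin 4), Even μ.length →
    ∀ F : C(B, ℂ), (∀ β : B, F β = (pdIter μ invSq β : ℝ)) → L F = 0

lemma AnnihilatesEven.dirIter {B : Set (Fin 4 → ℝ)} [CompactSpace B] {L : C(B, ℂ) →L[ℂ] ℂ}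
    (hL : AnnihilatesEven L) (hB : B ⊆ Vplus) (e : Fin 4 → ℝ) {n : ℕ} (hn : Even n)
    (F : C(B, ℂ)) (hF : ∀ β : B, F β = (dirIter e n β : ℝ)) : L F = 0 := by
  obtain ⟨χ, hχ, h⟩ := exists_mem_derivSpan_eqOn_dirIter e n
  have key : ∃ G : C(B, ℂ), (∀ β : B, G β = (χ β : ℝ)) ∧ L G = 0 := by
    clear h
    induction hχ using Submodule.span_induction with
    | mem ψ h =>
      obtain ⟨μ, hμ, rfl⟩ := h
      have hc : Continuous fun β : B => ((pdIter μ invSq β : ℝ) : ℂ) :=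
        Complex.continuous_ofReal.comp ((contDiffOn_pdIter μ).continuousOn.mono hB).domRestrict
      refine ⟨⟨_, hc⟩, fun β => rfl, hL μ ?_ _ fun β => rfl⟩
      rw [mem_ofPred_eq] at hμ
      rwa [hμ]
    | zero => exact ⟨0, by simp, by simp⟩
    | add ψ₁ ψ₂ _ _ h₁ h₂ =>
      obtain ⟨G₁, hG₁, h₁⟩ := h₁
      obtain ⟨G₂, hG₂, h₂⟩ := h₂
      exact ⟨G₁ + G₂, by simp [hG₁, hG₂], by simp [h₁, h₂]⟩
    | smul a ψ _ h =>
      obtain ⟨G, hG, h⟩ := h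
      exact ⟨(a : ℂ) • G, by simp [hG], by simp [h]⟩
  obtain ⟨G, hG, hLG⟩ := key
  rwa [show F = G from ContinuousMap.ext fun β => by rw [hF, hG, h (hB β.2)]]

lemma ContinuousLinearMap.iteratedDeriv_comp_left {E F : Type*} [NormedAddCommGroup E]
    [NormedSpace ℂ E] [NormedAddCommGroup F] [NormedSpace ℂ F] (L : E →L[ℂ] F) {v : ℂ → E}
    {x : ℂ} (hv : ContDiffAt ℂ ω v x) (n : ℕ) :
    iteratedDeriv n (fun s => L (v s)) x = L (iteratedDeriv n v x) := by
  have := L.iteratedFDeriv_comp_left (hv.of_le (n := ω) (m := n) le_top) le_rfl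
  simp only [iteratedDeriv]
  change iteratedFDeriv ℂ n (L ∘ v) x _ = _
  rw [this]
  rfl

/-- An odd function, holomorphic near the closed right half plane and vanishing at infinity
there, is zero on the right half plane, provided its oddness holds to all orders at `0`. -/
lemma eq_zero_of_odd_of_tendsto {g : ℂ → ℂ} {δ : ℝ} (hδ : 0 < δ)
    (hg : DifferentiableOn ℂ g {s | -δ < s.re})
    (heven : ∀ n, Even n → iteratedDeriv n g 0 = 0)
    {C R : ℝ} (hC : ∀ s : ℂ, 0 ≤ s.re → R ≤ ‖s‖ → ‖g s‖ ≤ C / ‖s‖) (s : ℂ) (hs : 0 ≤ s.re) :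
    g s = 0 := by
  have hU : IsOpen {s : ℂ | -δ < s.re} := isOpen_lt continuous_const Complex.continuous_re
  have hU' : IsOpen {s : ℂ | s.re < δ} := isOpen_lt Complex.continuous_re continuous_const
  have hgneg : DifferentiableOn ℂ (fun s => g (-s)) {s | s.re < δ} :=
    hg.comp differentiable_neg.differentiableOn fun s hs => by
      simp only [mem_ofPred_eq, Complex.neg_re] at hs ⊢; linarith
  set S : Set ℂ := {s | -δ < s.re} ∩ {s | s.re < δ} with hS
  have hSo : IsOpen S := hU.inter hU'
  have hk : DifferentiableOn ℂ (fun s => g s + g (-s)) S :=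
    (hg.mono inter_subset_left).add (hgneg.mono inter_subset_right)
  have h0S : (0 : ℂ) ∈ S := ⟨by simpa using hδ, by simpa using hδ⟩
  have hkz : ∀ᶠ s in 𝓝 (0 : ℂ), g s + g (-s) = 0 := by
    obtain ⟨r, hr, hrS⟩ := Metric.isOpen_iff.1 hSo 0 h0S
    filter_upwards [Metric.ball_mem_nhds (0 : ℂ) hr] with z hz
    have h1 := Complex.taylorSeries_eq_on_ball' hz (hk.mono hrS)
    rw [← h1]
    have hg0 : AnalyticAt ℂ g 0 := hg.analyticAt (hU.mem_nhds h0S.1)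
    have hg0' : AnalyticAt ℂ (fun s => g (-s)) 0 := hgneg.analyticAt (hU'.mem_nhds h0S.2)
    have : ∀ n, iteratedDeriv n (fun s => g s + g (-s)) 0 = 0 := fun n => by
      have := iteratedDeriv_add (n := n) hg0.contDiffAt hg0'.contDiffAt
      change iteratedDeriv n (g + fun s => g (-s)) 0 = 0
      rw [this, iteratedDeriv_comp_neg, neg_zero]
      rcases Nat.even_or_odd n with h | h
      · simp [heven n h]
      · simp [h.neg_one_pow]
    simp [this]
  have hodd : ∀ s ∈ S, g s + g (-s) = 0 := by
    have hconv : IsPreconnected S :=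
      ((convex_halfSpace_re_gt (-δ)).inter (convex_halfSpace_re_lt δ)).isPreconnected
    intro s hs
    exact (hk.analyticOnNhd hSo).eqOn_zero_of_preconnected_of_eventuallyEq_zero hconv h0S hkz hs
  classical
  set G : ℂ → ℂ := fun s => if 0 ≤ s.re then g s else -g (-s) with hG
  have hG1 : EqOn G g {s | -δ < s.re} := fun s hs => by
    simp only [hG]
    split_ifs with h
    · rfl
    · push Not at h
      linear_combination -hodd s ⟨hs, h.trans hδ⟩
  have hG2 : EqOn G (fun s => -g (-s)) {s | s.re < δ} := fun s hs => by
    simp only [hG]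
    split_ifs with h
    · linear_combination hodd s ⟨by simp only [mem_ofPred_eq]; linarith, hs⟩
    · rfl
  have hGd : Differentiable ℂ G := fun s => by
    rcases lt_or_ge s.re δ with h | h
    · have := hgneg.neg.congr hG2
      exact this.differentiableAt (hU'.mem_nhds h)
    · have := hg.congr hG1
      exact this.differentiableAt (hU.mem_nhds (show -δ < s.re by linarith))
  have hGt : Tendsto G (cocompact ℂ) (𝓝 0) := by
    have ht : Tendsto (fun s : ℂ => C / ‖s‖) (cocompact ℂ) (𝓝 0) :=
      tendsto_const_nhds.div_atTop tendsto_norm_cocompact_atTop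
    refine squeeze_zero_norm' ?_ ht
    filter_upwards [tendsto_norm_cocompact_atTop.eventually (eventually_ge_atTop R)] with s hs
    simp only [hG]
    split_ifs with h
    · exact hC s h hs
    · have := hC (-s) (by simp only [Complex.neg_re]; linarith) (by rwa [norm_neg])
      rw [norm_neg]
      rwa [norm_neg] at this
  have := hGd.apply_eq_of_tendsto_cocompact s hGt
  simpa [hG, hs] using this

lemma quadratic_ne_zero {a b c δ : ℝ} (hb : 0 < b) (hc : 0 < c)
    (h1 : 2 * c * δ ≤ b) (h2 : b * δ ≤ a) {s : ℂ} (hs : -δ < s.re) :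
    (a : ℂ) + s * b + s ^ 2 * c ≠ 0 := by
  intro h
  have hre := congrArg Complex.re h
  have him := congrArg Complex.im h
  simp only [pow_two, Complex.add_re, Complex.add_im, Complex.mul_re, Complex.mul_im,
    Complex.ofReal_re, Complex.ofReal_im, Complex.zero_re, Complex.zero_im] at hre him
  have him' : s.im * (2 * c * s.re + b) = 0 := by linear_combination him
  rcases mul_eq_zero.1 him' with h0 | h0
  · rw [h0] at hre
    nlinarith [mul_pos hc (sub_pos.2 hs), sq_nonneg s.re, mul_pos hb (sub_pos.2 hs)]
  · nlinarith [mul_pos hc (sub_pos.2 hs)]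

lemma inverse_apply_of_isUnit {X : Type*} [TopologicalSpace X] {F : C(X, ℂ)}
    (hF : IsUnit F) (β : X) :
    Ring.inverse F β = (F β)⁻¹ := by
  have h := congrArg (fun G : C(X, ℂ) => G β) (Ring.inverse_mul_cancel F hF)
  exact eq_inv_of_mul_eq_one_left (by simpa using h)

section Pencil

variable {B : Set (Fin 4 → ℝ)} [CompactSpace B] (e : Fin 4 → ℝ)

/-- The function `β ↦ (β + s e)²` on `B`, for complex `s`. -/
def pencil (B : Set (Fin 4 → ℝ)) [CompactSpace B] (e : Fin 4 → ℝ) (s : ℂ) : C(B, ℂ) :=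
  (⟨fun β : B => ((mink β β : ℝ) : ℂ), Complex.continuous_ofReal.comp
      (contDiff_mink_self.continuous.comp continuous_subtype_val)⟩ : C(B, ℂ)) +
    s • (⟨fun β : B => ((2 * mink β e : ℝ) : ℂ), Complex.continuous_ofReal.comp
      (continuous_const.mul ((continuous_mink_left e).comp continuous_subtype_val))⟩ : C(B, ℂ)) +
    s ^ 2 • (⟨fun _ : B => ((mink e e : ℝ) : ℂ), continuous_const⟩ : C(B, ℂ))

lemma pencil_apply (s : ℂ) (β : B) :
    pencil B e s β = (mink β β : ℝ) + s * (2 * mink β e : ℝ) + s ^ 2 * (mink e e : ℝ) := rfl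

lemma pencil_ofReal_apply (s : ℝ) (β : B) :
    pencil B e s β = (mink (β + s • e) (β + s • e) : ℝ) := by
  rw [pencil_apply, mink_add_smul_self]
  push_cast
  ring

lemma differentiable_pencil : Differentiable ℂ (pencil B e) := by
  unfold pencil
  fun_prop

variable {e}

lemma exists_isUnit_pencil (hB : B ⊆ Vplus) (he : e ∈ Vplus) :
    ∃ δ > 0, ∀ s : ℂ, -δ < s.re → IsUnit (pencil B e s) := by
  have hBc : IsCompact B := isCompact_iff_compactSpace.2 inferInstance
  obtain ⟨m, hm, hmB⟩ := hBc.exists_forall_le' (f := fun β => mink β β)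
    contDiff_mink_self.continuous.continuousOn (a := 0) fun β hβ => (hB hβ).2
  obtain ⟨m', hm', hmB'⟩ := hBc.exists_forall_le' (f := fun β => mink β e)
    (continuous_mink_left e).continuousOn (a := 0) fun β hβ => mink_pos (hB hβ) he
  obtain ⟨M, hM⟩ := hBc.bddAbove_image (f := fun β => mink β e)
    (continuous_mink_left e).continuousOn
  have hM' : ∀ β ∈ B, mink β e ≤ |M| + 1 := fun β hβ => by
    have := hM ⟨β, hβ, rfl⟩
    have := le_abs_self M
    simp only at *
    linarith
  have hee := he.2
  have hM0 : 0 < |M| + 1 := by positivity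
  refine ⟨min (m' / mink e e) (m / (2 * (|M| + 1))), by positivity, fun s hs => ?_⟩
  rw [ContinuousMap.isUnit_iff_forall_ne_zero]
  intro β
  rw [pencil_apply]
  have hδ1 := min_le_left (m' / mink e e) (m / (2 * (|M| + 1)))
  have hδ2 := min_le_right (m' / mink e e) (m / (2 * (|M| + 1)))
  have hδ0 : 0 < min (m' / mink e e) (m / (2 * (|M| + 1))) := by positivity
  rw [le_div_iff₀ (by positivity)] at hδ1 hδ2
  refine quadratic_ne_zero (mul_pos two_pos (mink_pos (hB β.2) he)) hee ?_ ?_ hs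
  · nlinarith [hmB' β β.2]
  · have h1 := mul_le_mul_of_nonneg_right (hM' β β.2) hδ0.le
    nlinarith [hmB β β.2]

lemma norm_inverse_pencil_le (hB : B ⊆ Vplus) (he : e ∈ Vplus) :
    ∃ R, ∀ s : ℂ, 0 ≤ s.re → R ≤ ‖s‖ → ‖Ring.inverse (pencil B e s)‖ ≤ 1 / ‖s‖ := by
  obtain ⟨δ, hδ, hunit⟩ := exists_isUnit_pencil hB he
  have hBc : IsCompact B := isCompact_iff_compactSpace.2 inferInstance
  obtain ⟨M₁, hM₁⟩ := hBc.bddAbove_image (f := fun β => mink β β)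
    contDiff_mink_self.continuous.continuousOn
  obtain ⟨M₂, hM₂⟩ := hBc.bddAbove_image (f := fun β => mink β e)
    (continuous_mink_left e).continuousOn
  have hee : 0 < mink e e := he.2
  refine ⟨max 1 ((|M₁| + 2 * |M₂| + 1) / mink e e), fun s hs hR => ?_⟩
  have hs1 : 1 ≤ ‖s‖ := (le_max_left _ _).trans hR
  have hs2 := (le_max_right _ _).trans hR
  rw [div_le_iff₀ hee] at hs2
  rw [ContinuousMap.norm_le _ (by positivity)]
  intro β
  rw [inverse_apply_of_isUnit (hunit s (by linarith)), norm_inv, ← one_div]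
  refine one_div_le_one_div_of_le (by linarith) ?_
  rw [pencil_apply]
  have hb1 : mink β β ≤ |M₁| := (hM₁ ⟨β, β.2, rfl⟩).trans (le_abs_self _)
  have hb2 : mink β e ≤ |M₂| := (hM₂ ⟨β, β.2, rfl⟩).trans (le_abs_self _)
  have hp1 := (hB β.2).2
  have hp2 := mink_pos (hB β.2) he
  have h1 := norm_sub_le ((mink β β : ℝ) + s * (2 * mink β e : ℝ) + s ^ 2 * (mink e e : ℝ) : ℂ)
    ((mink β β : ℝ) + s * (2 * mink β e : ℝ) : ℂ)
  have h2 := norm_add_le ((mink β β : ℝ) : ℂ) (s * (2 * mink β e : ℝ) : ℂ)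
  rw [add_sub_cancel_left] at h1
  rw [norm_mul, norm_pow, Complex.norm_real, Real.norm_of_nonneg hee.le] at h1
  rw [norm_mul, Complex.norm_real, Complex.norm_real, Real.norm_of_nonneg hp1.le,
    Real.norm_of_nonneg (by positivity)] at h2
  have h3 : ‖s‖ * (2 * mink β e) ≤ ‖s‖ * (2 * |M₂|) := by gcongr
  have h4 := mul_le_mul_of_nonneg_left hs2 (norm_nonneg s)
  have h5 : |M₁| ≤ ‖s‖ * |M₁| := le_mul_of_one_le_left (abs_nonneg _) hs1
  nlinarith

lemma differentiableAt_inverse_pencil {s : ℂ} (h : IsUnit (pencil B e s)) :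
    DifferentiableAt ℂ (fun s => Ring.inverse (pencil B e s)) s :=
  (differentiableAt_inverse h).comp s (differentiable_pencil e s)

lemma analyticAt_inverse_pencil {s : ℂ} (h : IsUnit (pencil B e s)) :
    AnalyticAt ℂ (fun s => Ring.inverse (pencil B e s)) s := by
  rw [Complex.analyticAt_iff_eventually_differentiableAt]
  filter_upwards [(differentiable_pencil e).continuous.continuousAt.eventually
    (Units.isOpen.mem_nhds h)] with z hz
  exact differentiableAt_inverse_pencil hz

lemma iteratedDeriv_inverse_pencil_apply (hB : B ⊆ Vplus) (he : e ∈ Vplus) (n : ℕ) (β : B) :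
    iteratedDeriv n (fun s => Ring.inverse (pencil B e s)) 0 β = (dirIter e n β : ℝ) := by
  obtain ⟨δ, hδ, hunit⟩ := exists_isUnit_pencil hB he
  have han := analyticAt_inverse_pencil (hunit 0 (by simpa using hδ))
  set γ : ℂ → ℂ := fun s => Ring.inverse (pencil B e s) β
  have hγ : AnalyticAt ℂ γ 0 :=
    AnalyticAt.comp (g := (ContinuousMap.evalCLM ℂ β : C(B, ℂ) →L[ℂ] ℂ))
      (f := fun s => Ring.inverse (pencil B e s)) (ContinuousLinearMap.analyticAt _ _) han
  have h0 := (ContinuousMap.evalCLM ℂ β).iteratedDeriv_comp_left han.contDiffAt n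
  simp only [ContinuousMap.evalCLM_apply] at h0
  rw [← h0]
  change iteratedDeriv n γ 0 = _
  have hV : ∀ᶠ s : ℝ in 𝓝 0, (β : Fin 4 → ℝ) + s • e ∈ Vplus := by
    have hc : ContinuousAt (fun s : ℝ => (β : Fin 4 → ℝ) + s • e) 0 := by fun_prop
    exact hc.eventually (isOpen_Vplus.mem_nhds (by simpa using hB β.2))
  have key : ∀ᶠ s : ℝ in 𝓝 0, iteratedDeriv n γ (s : ℂ) = (dirIter e n (β + s • e) : ℝ) := by
    induction n with
    | zero =>
      filter_upwards [hV, eventually_gt_nhds (show -δ < 0 by linarith)] with s hs hs'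
      simp only [iteratedDeriv_zero, γ]
      rw [inverse_apply_of_isUnit (hunit s (by simpa using hs')), pencil_ofReal_apply]
      simp [dirIter, invSq]
    | succ n ih =>
      have hd : ∀ᶠ s : ℝ in 𝓝 0, DifferentiableAt ℂ (iteratedDeriv n γ) (s : ℂ) := by
        have h1 := (hγ.iterated_deriv n).eventually_analyticAt
        rw [← iteratedDeriv_eq_iterate] at h1
        have h2 : Tendsto (fun s : ℝ => (s : ℂ)) (𝓝 0) (𝓝 ((0 : ℝ) : ℂ)) :=
          Complex.continuous_ofReal.tendsto 0
        filter_upwards [h2.eventually (by simpa using h1)] with s hs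
        exact hs.differentiableAt
      filter_upwards [(ih (((ContinuousMap.evalCLM ℂ β).iteratedDeriv_comp_left
        han.contDiffAt n))).eventually_nhds, hd, hV] with s hs hds hVs
      have e1 := hds.hasDerivAt.comp_ofReal
      have e2 := (hasDerivAt_dirIter e n β s hVs).ofReal_comp
      rw [iteratedDeriv_succ]
      exact (e1.congr_of_eventuallyEq (hs.mono fun _ h => h.symm)).unique e2
  have := key.self_of_nhds
  simpa using this

end Pencil

lemma AnnihilatesEven.invSq_add {B : Set (Fin 4 → ℝ)} [CompactSpace B] {L : C(B, ℂ) →L[ℂ] ℂ}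
    (hL : AnnihilatesEven L) (hB : B ⊆ Vplus) {e : Fin 4 → ℝ} (he : e ∈ Vplus)
    (F : C(B, ℂ)) (hF : ∀ β : B, F β = (invSq (β + e) : ℝ)) : L F = 0 := by
  obtain ⟨δ, hδ, hunit⟩ := exists_isUnit_pencil hB he
  obtain ⟨R, hR⟩ := norm_inverse_pencil_le hB he
  have h := eq_zero_of_odd_of_tendsto (g := fun s => L (Ring.inverse (pencil B e s))) hδ
    (fun s hs => (L.differentiableAt.comp s
      (differentiableAt_inverse_pencil (hunit s hs))).differentiableWithinAt)
    (fun n hn => by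
      rw [L.iteratedDeriv_comp_left
        (analyticAt_inverse_pencil (hunit 0 (by simpa using hδ))).contDiffAt]
      exact hL.dirIter hB e hn _ fun β => iteratedDeriv_inverse_pencil_apply hB he n β)
    (C := ‖L‖) (R := R) (fun s hs hRs => by
      rw [div_eq_mul_one_div]
      exact (L.le_opNorm _).trans (by gcongr; exact hR s hs hRs)) 1 (by simp)
  rwa [show F = Ring.inverse (pencil B e 1) from ContinuousMap.ext fun β => by
    rw [hF, inverse_apply_of_isUnit (hunit 1 (by simp; linarith))]
    have := pencil_ofReal_apply e 1 β
    simp only [Complex.ofReal_one, one_smul] at this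
    rw [this]
    simp [invSq]]

/-- Taylor coefficients of `u ↦ ((1 - u a)(1 - u b))⁻¹` are annihilated by a functional which
annihilates its values along the negative real axis. -/
lemma map_sum_antidiagonal_eq_zero {R : Type*} [NormedCommRing R] [NormedAlgebra ℂ R]
    [CompleteSpace R] (L : R →L[ℂ] ℂ) (a b : R) {ε : ℝ} (hε : 0 < ε)
    (h : ∀ u : ℝ, -ε < u → u < 0 → ∀ F : R,
      F * ((1 - (u : ℂ) • a) * (1 - (u : ℂ) • b)) = 1 → L F = 0) (n : ℕ) :
    L (∑ kl ∈ Finset.HasAntidiagonal.antidiagonal n, a ^ kl.1 * b ^ kl.2) = 0 := by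
  set c : ℕ → R := fun n =>
    ∑ kl ∈ Finset.HasAntidiagonal.antidiagonal n, a ^ kl.1 * b ^ kl.2 with hc
  have hsmall : ∀ x : R, ∀ᶠ u : ℂ in 𝓝 0, ‖u • x‖ < 1 := fun x => by
    have : Tendsto (fun u : ℂ => ‖u • x‖) (𝓝 0) (𝓝 ‖(0 : ℂ) • x‖) := by
      apply Continuous.tendsto
      fun_prop
    rw [zero_smul, norm_zero] at this
    exact this.eventually (gt_mem_nhds one_pos)
  have hterm : ∀ (u : ℂ) (n : ℕ),
      ∑ kl ∈ Finset.HasAntidiagonal.antidiagonal n, (u • a) ^ kl.1 * (u • b) ^ kl.2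
      = u ^ n • c n := fun u n => by
    rw [hc, Finset.smul_sum]
    refine Finset.sum_congr rfl fun kl hkl => ?_
    rw [Finset.HasAntidiagonal.mem_antidiagonal] at hkl
    rw [smul_pow, smul_pow, smul_mul_smul_comm, ← pow_add, hkl]
  have hsum : ∀ u : ℂ, ‖u • a‖ < 1 → ‖u • b‖ < 1 →
      HasSum (fun n => u ^ n • c n) ((∑' n, (u • a) ^ n) * ∑' n, (u • b) ^ n) := by
    intro u ha hb
    have sa' : Summable fun n => ‖(u • a) ^ n‖ := by
      simpa using summable_norm_pow_mul_geometric_of_norm_lt_one 0 ha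
    have sb' : Summable fun n => ‖(u • b) ^ n‖ := by
      simpa using summable_norm_pow_mul_geometric_of_norm_lt_one 0 hb
    rw [tsum_mul_tsum_eq_tsum_sum_antidiagonal_of_summable_norm sa' sb']
    simp_rw [hterm]
    have := (summable_norm_sum_mul_antidiagonal_of_summable_norm sa' sb').of_norm
    simp_rw [hterm] at this
    exact this.hasSum
  set f : ℂ → ℂ := fun u => L ((∑' n, (u • a) ^ n) * ∑' n, (u • b) ^ n) with hf
  set p : FormalMultilinearSeries ℂ ℂ ℂ := FormalMultilinearSeries.ofScalars ℂ fun n => L (c n)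
    with hp
  have hfp : HasFPowerSeriesAt f p 0 := by
    rw [hasFPowerSeriesAt_iff]
    filter_upwards [hsmall a, hsmall b] with u ha hb
    have := (hsum u ha hb).mapL L
    simpa [hp, hf] using this
  have hfreq : ∃ᶠ u in 𝓝[≠] (0 : ℂ), f u = 0 := by
    have hlim : Tendsto (fun u : ℝ => (u : ℂ)) (𝓝[<] 0) (𝓝[≠] 0) := by
      refine tendsto_nhdsWithin_iff.2 ⟨?_, ?_⟩
      · exact (Complex.continuous_ofReal.tendsto' 0 0 (by simp)).mono_left nhdsWithin_le_nhds
      · filter_upwards [self_mem_nhdsWithin] with u hu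
        simpa using (show u < 0 from hu).ne
    refine hlim.frequently (Eventually.frequently ?_)
    filter_upwards [self_mem_nhdsWithin,
      nhdsWithin_le_nhds (lt_mem_nhds (show -ε < 0 by linarith)),
      hlim.eventually (nhdsWithin_le_nhds (hsmall a)),
      hlim.eventually (nhdsWithin_le_nhds (hsmall b))] with u hu hu' ha hb
    refine h u hu' hu _ ?_
    rw [mul_mul_mul_comm, geom_series_mul_neg _ ha, geom_series_mul_neg _ hb, one_mul]
  have hz : f =ᶠ[𝓝 0] 0 := hfp.analyticAt.frequently_zero_iff_eventually_zero.1 hfreq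
  have hp0 : p = 0 := (hfp.congr hz).eq_zero
  have := congrArg (fun q : FormalMultilinearSeries ℂ ℂ ℂ => q.coeff n) hp0
  rw [hp, FormalMultilinearSeries.coeff_ofScalars] at this
  exact this

/-- The spherical wave `∫_{-1}^1 φ(t + λ |x - y|) dλ` with profile `φ` and centre `y`. -/
def sphWave (φ : ℝ → ℂ) (y : EuclideanSpace ℝ (Fin 3)) (p : Fin 4 → ℝ) : ℂ :=
  ∫ l in (-1 : ℝ)..1, φ (p 0 + l * ‖spatial p - y‖)

lemma integral_pow_add_mul (t r : ℝ) (n : ℕ) :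
    ∫ l in (-1 : ℝ)..1, (((t + l * r : ℝ) : ℂ)) ^ n =
      2 / (n + 1) * ∑ kl ∈ Finset.HasAntidiagonal.antidiagonal n,
        ((t + r : ℝ) : ℂ) ^ kl.1 * ((t - r : ℝ) : ℂ) ^ kl.2 := by
  have key : ∫ l in (-1 : ℝ)..1, (t + l * r) ^ n =
      2 / (n + 1) *
        ∑ kl ∈ Finset.HasAntidiagonal.antidiagonal n, (t + r) ^ kl.1 * (t - r) ^ kl.2 := by
    rcases eq_or_ne r 0 with rfl | hr
    · simp only [mul_zero, add_zero, sub_zero, intervalIntegral.integral_const]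
      rw [Finset.sum_congr rfl (g := fun _ => t ^ n) fun kl hkl => by
        rw [← pow_add, Finset.HasAntidiagonal.mem_antidiagonal.1 hkl]]
      simp
      field_simp
      ring
    · have h1 := intervalIntegral.smul_integral_comp_add_mul (a := -1) (b := 1)
        (fun v : ℝ => v ^ n) r t
      rw [integral_pow] at h1
      have h2 : (∑ kl ∈ Finset.HasAntidiagonal.antidiagonal n,
          (t + r) ^ kl.1 * (t - r) ^ kl.2) * (2 * r)
          = (t + r) ^ (n + 1) - (t - r) ^ (n + 1) := by
        rw [Finset.Nat.sum_antidiagonal_eq_sum_range_succ_mk]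
        have := (Commute.all (t + r) (t - r)).geom_sum₂_mul (n + 1)
        rw [← this]
        congr 1
        ring
      have h3 : (n + 1 : ℝ) ≠ 0 := by positivity
      apply mul_left_cancel₀ hr
      simp only [smul_eq_mul] at h1
      simp_rw [mul_comm _ r]
      rw [h1]
      field_simp
      field_simp at h2
      rw [← sub_eq_add_neg, ← h2]
      ring
  have := congrArg (fun x : ℝ => (x : ℂ)) key
  push_cast at this ⊢
  rw [← this, ← intervalIntegral.integral_ofReal]
  push_cast
  rfl

section

variable {B : Set (Fin 4 → ℝ)} [CompactSpace B] {L : C(B, ℂ) →L[ℂ] ℂ}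

lemma AnnihilatesEven.antidiagonal (hL : AnnihilatesEven L) (hB : B ⊆ Vplus)
    (y : EuclideanSpace ℝ (Fin 3)) (n : ℕ) (F : C(B, ℂ))
    (hF : ∀ β : B, F β = ∑ kl ∈ Finset.HasAntidiagonal.antidiagonal n,
      (((β : Fin 4 → ℝ) 0 + ‖spatial β - y‖ : ℝ) : ℂ) ^ kl.1 *
      (((β : Fin 4 → ℝ) 0 - ‖spatial β - y‖ : ℝ) : ℂ) ^ kl.2) : L F = 0 := by
  set a : C(B, ℂ) := ⟨fun β => (((β : Fin 4 → ℝ) 0 + ‖spatial β - y‖ : ℝ) : ℂ),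
    (show Continuous fun p : Fin 4 → ℝ => ((p 0 + ‖spatial p - y‖ : ℝ) : ℂ) from
      Complex.continuous_ofReal.comp (by fun_prop)).comp continuous_subtype_val⟩
  set b : C(B, ℂ) := ⟨fun β => (((β : Fin 4 → ℝ) 0 - ‖spatial β - y‖ : ℝ) : ℂ),
    (show Continuous fun p : Fin 4 → ℝ => ((p 0 - ‖spatial p - y‖ : ℝ) : ℂ) from
      Complex.continuous_ofReal.comp (by fun_prop)).comp continuous_subtype_val⟩
  have hFab : F = ∑ kl ∈ Finset.HasAntidiagonal.antidiagonal n, a ^ kl.1 * b ^ kl.2 := by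
    ext β
    rw [hF, ContinuousMap.sum_apply]
    rfl
  rw [hFab]
  refine map_sum_antidiagonal_eq_zero L a b (ε := 1 / (‖y‖ + 1)) (by positivity) ?_ n
  intro u hu hu0 G hG
  set σ : ℝ := -u⁻¹ with hσ
  have hσpos : 0 < σ := by rw [hσ]; simpa using hu0
  have hσy : ‖y‖ < σ := by
    have h1 : -u < 1 / (‖y‖ + 1) := by linarith
    rw [lt_div_iff₀ (by positivity)] at h1
    have : σ * -u = 1 := by rw [hσ, neg_mul_neg, inv_mul_cancel₀ hu0.ne]
    nlinarith [norm_nonneg y]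
  set e : Fin 4 → ℝ := Fin.cons σ fun i => -(y i) with he
  have hse : spatial e = -y := by ext i; simp [he]
  have heV : e ∈ Vplus := by
    rw [mem_Vplus_iff, hse, norm_neg]
    simpa [he] using hσy
  have hG' : ∀ β : B, ((u : ℂ) ^ 2 • G) β = (invSq (β + e) : ℝ) := by
    intro β
    have h1 := congrArg (fun H : C(B, ℂ) => H β) hG
    have h2 : mink (β + e) (β + e) = (σ + ((β : Fin 4 → ℝ) 0 + ‖spatial β - y‖)) *
        (σ + ((β : Fin 4 → ℝ) 0 - ‖spatial β - y‖)) := by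
      rw [mink_self_eq, map_add, hse, ← sub_eq_add_neg]
      simp only [he, Pi.add_apply, Fin.cons_zero]
      ring
    simp only [ContinuousMap.mul_apply, ContinuousMap.sub_apply, ContinuousMap.one_apply,
      ContinuousMap.smul_apply, smul_eq_mul] at h1 ⊢
    rw [invSq, h2, Complex.ofReal_inv]
    apply eq_inv_of_mul_eq_one_left
    rw [← h1, hσ]
    have : (u : ℂ) ≠ 0 := by simpa using hu0.ne
    simp only [a, b, ContinuousMap.coe_mk]
    push_cast
    field_simp
    ring
  have := hL.invSq_add hB heV _ hG'
  rw [map_smul, smul_eq_mul, mul_eq_zero] at this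
  exact this.resolve_left (by simpa using hu0.ne)

lemma continuous_sphWave {φ : ℝ → ℂ} (hφ : Continuous φ) (y : EuclideanSpace ℝ (Fin 3)) :
    Continuous (sphWave φ y) := by
  unfold sphWave
  apply intervalIntegral.continuous_parametric_intervalIntegral_of_continuous'
  unfold Function.uncurry
  fun_prop

/-- The restriction of a spherical wave to `B`. -/
def sphWaveMap (B : Set (Fin 4 → ℝ)) {φ : ℝ → ℂ} (hφ : Continuous φ)
    (y : EuclideanSpace ℝ (Fin 3)) : C(B, ℂ) :=
  ⟨fun β => sphWave φ y β, (continuous_sphWave hφ y).comp continuous_subtype_val⟩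

lemma AnnihilatesEven.sphWave_pow (hL : AnnihilatesEven L) (hB : B ⊆ Vplus)
    (y : EuclideanSpace ℝ (Fin 3)) (n : ℕ) :
    L (sphWaveMap B (φ := fun v => (v : ℂ) ^ n) (by fun_prop) y) = 0 := by
  set F : C(B, ℂ) := sphWaveMap B (φ := fun v => (v : ℂ) ^ n) (by fun_prop) y with hF
  have hn : (n + 1 : ℂ) ≠ 0 := by exact_mod_cast n.succ_ne_zero
  have h := hL.antidiagonal hB y n (((n + 1) / 2 : ℂ) • F) fun β => by
    rw [ContinuousMap.smul_apply, hF]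
    simp only [sphWaveMap, ContinuousMap.coe_mk, sphWave, smul_eq_mul]
    rw [integral_pow_add_mul]
    field_simp
  rw [map_smul, smul_eq_mul, mul_eq_zero] at h
  exact h.resolve_left (div_ne_zero hn two_ne_zero)

end

section

variable {B : Set (Fin 4 → ℝ)} [CompactSpace B] {L : C(B, ℂ) →L[ℂ] ℂ}

lemma AnnihilatesEven.sphWave_poly (hL : AnnihilatesEven L) (hB : B ⊆ Vplus)
    (y : EuclideanSpace ℝ (Fin 3)) (P : Polynomial ℂ) :
    L (sphWaveMap B (φ := fun v => P.eval (v : ℂ))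
      (P.continuous.comp Complex.continuous_ofReal) y) = 0 := by
  have : sphWaveMap B (φ := fun v => P.eval (v : ℂ))
      (P.continuous.comp Complex.continuous_ofReal) y =
      ∑ n ∈ Finset.range (P.natDegree + 1), P.coeff n •
        sphWaveMap B (φ := fun v => (v : ℂ) ^ n) (by fun_prop) y := by
    ext β
    rw [ContinuousMap.sum_apply]
    simp only [sphWaveMap, ContinuousMap.smul_apply, ContinuousMap.coe_mk, sphWave, smul_eq_mul,
      Polynomial.eval_eq_sum_range]
    rw [intervalIntegral.integral_finsetSum]
    · simp_rw [intervalIntegral.integral_const_mul]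
    · intro n _
      apply Continuous.intervalIntegrable
      fun_prop
  rw [this, map_sum]
  refine Finset.sum_eq_zero fun n _ => ?_
  rw [map_smul, hL.sphWave_pow hB, smul_zero]

lemma exists_complex_polynomial_near (a b : ℝ) {φ : ℝ → ℂ} (hφ : Continuous φ) {δ : ℝ}
    (hδ : 0 < δ) : ∃ P : Polynomial ℂ, ∀ v ∈ Icc a b, ‖P.eval (v : ℂ) - φ v‖ < δ := by
  obtain ⟨p, hp⟩ := exists_polynomial_near_of_continuousOn a b (fun v => (φ v).re)
    (Complex.continuous_re.comp hφ).continuousOn (δ / 2) (by positivity)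
  obtain ⟨q, hq⟩ := exists_polynomial_near_of_continuousOn a b (fun v => (φ v).im)
    (Complex.continuous_im.comp hφ).continuousOn (δ / 2) (by positivity)
  refine ⟨p.map Complex.ofRealHom + Polynomial.C Complex.I * q.map Complex.ofRealHom,
    fun v hv => ?_⟩
  have e1 : (p.map Complex.ofRealHom).eval (v : ℂ) = (p.eval v : ℝ) :=
    Polynomial.eval_map_apply (Complex.ofRealHom) v
  have e2 : (q.map Complex.ofRealHom).eval (v : ℂ) = (q.eval v : ℝ) :=
    Polynomial.eval_map_apply (Complex.ofRealHom) v
  rw [Polynomial.eval_add, Polynomial.eval_mul, Polynomial.eval_C, e1, e2]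
  refine (Complex.norm_le_abs_re_add_abs_im _).trans_lt ?_
  have h1 := hp v hv
  have h2 := hq v hv
  simp
  linarith

/-- A functional annihilating the even derivatives of `(β·β)⁻¹` annihilates all spherical
waves. -/
lemma AnnihilatesEven.sphWave (hL : AnnihilatesEven L) (hB : B ⊆ Vplus)
    (y : EuclideanSpace ℝ (Fin 3)) {φ : ℝ → ℂ} (hφ : Continuous φ) :
    L (sphWaveMap B hφ y) = 0 := by
  obtain ⟨M, hM⟩ : ∃ M : ℝ, ∀ β : B, |(β : Fin 4 → ℝ) 0| + ‖spatial β - y‖ ≤ M := by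
    have hc : Continuous fun β : B => |(β : Fin 4 → ℝ) 0| + ‖spatial β - y‖ :=
      (show Continuous fun p : Fin 4 → ℝ => |p 0| + ‖spatial p - y‖ by fun_prop).comp
        continuous_subtype_val
    obtain ⟨M, hM⟩ := (isCompact_range hc).bddAbove
    exact ⟨M, fun β => hM ⟨β, rfl⟩⟩
  refine norm_le_zero_iff.1 (le_of_forall_pos_le_add fun δ hδ => ?_)
  obtain ⟨P, hP⟩ := exists_complex_polynomial_near (-M) M hφ
    (δ := δ / (2 * (‖L‖ + 1))) (by positivity)
  have hd : ‖sphWaveMap B hφ y - sphWaveMap B (φ := fun v => P.eval (v : ℂ))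
      (P.continuous.comp Complex.continuous_ofReal) y‖ ≤ δ / (‖L‖ + 1) := by
    rw [ContinuousMap.norm_le _ (by positivity)]
    intro β
    simp only [sphWaveMap, ContinuousMap.sub_apply, ContinuousMap.coe_mk, _root_.sphWave]
    have c1 : Continuous fun l : ℝ => φ ((β : Fin 4 → ℝ) 0 + l * ‖spatial β - y‖) := by fun_prop
    have c2 : Continuous fun l : ℝ =>
        P.eval (((β : Fin 4 → ℝ) 0 + l * ‖spatial β - y‖ : ℝ) : ℂ) :=
      P.continuous.comp (Complex.continuous_ofReal.comp (by fun_prop))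
    rw [← intervalIntegral.integral_sub (c1.intervalIntegrable _ _) (c2.intervalIntegrable _ _)]
    refine (intervalIntegral.norm_integral_le_of_norm_le_const
      (C := δ / (2 * (‖L‖ + 1))) fun l hl => ?_).trans_eq ?_
    · rw [norm_sub_rev]
      refine (hP _ ?_).le
      rw [uIoc_of_le (by norm_num)] at hl
      rw [mem_Icc, ← abs_le]
      refine (abs_add_le _ _).trans (le_trans ?_ (hM β))
      rw [abs_mul, abs_norm]
      gcongr
      exact mul_le_of_le_one_left (norm_nonneg _) (abs_le.2 ⟨hl.1.le, hl.2⟩)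
    · norm_num
      field_simp
  have h0 := hL.sphWave_poly hB y P
  have : L (sphWaveMap B hφ y) = L (sphWaveMap B hφ y - sphWaveMap B (φ := fun v => P.eval (v : ℂ))
      (P.continuous.comp Complex.continuous_ofReal) y) := by rw [map_sub, h0, sub_zero]
  rw [this, zero_add]
  refine (L.le_opNorm _).trans ((mul_le_mul_of_nonneg_left hd (norm_nonneg _)).trans ?_)
  rw [mul_div_assoc', div_le_iff₀ (by positivity)]
  nlinarith [norm_nonneg L]

end

/-- The inclusion of space into spacetime at time zero. -/
def embed : EuclideanSpace ℝ (Fin 3) →L[ℝ] (Fin 4 → ℝ) :=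
  LinearMap.toContinuousLinearMap
    { toFun := fun z => Fin.cons 0 fun i => z i
      map_add' := fun z w => by ext i; refine Fin.cases ?_ (fun j => ?_) i <;> simp
      map_smul' := fun c z => by ext i; refine Fin.cases ?_ (fun j => ?_) i <;> simp }

@[simp] lemma embed_zero_apply (z : EuclideanSpace ℝ (Fin 3)) : embed z 0 = 0 := rfl

@[simp] lemma embed_succ_apply (z : EuclideanSpace ℝ (Fin 3)) (i : Fin 3) :
    embed z i.succ = z i := rfl

lemma embed_single (i : Fin 3) : embed (EuclideanSpace.single i 1) = Pi.single i.succ 1 := by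
  ext k
  refine Fin.cases ?_ (fun j => ?_) k
  · simp
  · simp [Pi.single_apply]

@[simp] lemma spatial_embed (z : EuclideanSpace ℝ (Fin 3)) : spatial (embed z) = z := by
  ext i; simp

/-- The spacetime point at time `s` and position `z` relative to `p`. -/
def shift (p : Fin 4 → ℝ) (s : ℝ) (z : EuclideanSpace ℝ (Fin 3)) : Fin 4 → ℝ :=
  p + s • Pi.single 0 1 + embed z

@[simp] lemma shift_zero_apply (p : Fin 4 → ℝ) (s : ℝ) (z : EuclideanSpace ℝ (Fin 3)) :
    shift p s z 0 = p 0 + s := by simp [shift]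

@[simp] lemma spatial_shift (p : Fin 4 → ℝ) (s : ℝ) (z : EuclideanSpace ℝ (Fin 3)) :
    spatial (shift p s z) = spatial p + z := by
  have : spatial (Pi.single 0 1) = 0 := by ext i; simp
  simp [shift, this]

lemma continuous_shift (p : Fin 4 → ℝ) :
    Continuous fun q : ℝ × EuclideanSpace ℝ (Fin 3) => shift p q.1 q.2 := by
  unfold shift; fun_prop

lemma hasCompactSupport_comp_shift {E : Type*} [Zero E] {f : (Fin 4 → ℝ) → E}
    (hf : HasCompactSupport f) (p : Fin 4 → ℝ) {a : EuclideanSpace ℝ (Fin 3) → ℝ}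
    (ha : Continuous a) : HasCompactSupport fun z => f (shift p (a z) z) := by
  refine hf.comp_isClosedEmbedding (g := fun z => shift p (a z) z)
    (Function.LeftInverse.isClosedEmbedding (f := fun q => spatial q - spatial p)
      (fun z => by simp) (by fun_prop) ((continuous_shift p).comp (ha.prodMk continuous_id)))

section

variable {E : Type*} [NormedAddCommGroup E] [NormedSpace ℝ E] {g : (Fin 4 → ℝ) → E}

lemma ContDiff.pd (hg : ContDiff ℝ ∞ g) (ν : Fin 4) : ContDiff ℝ ∞ (pd ν g) :=
  (hg.fderiv_right (m := ∞) (by simp)).clm_apply contDiff_const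

lemma HasCompactSupport.pd (hg : HasCompactSupport g) (ν : Fin 4) :
    HasCompactSupport (pd ν g) :=
  (hg.fderiv ℝ).comp_left (g := fun L : (Fin 4 → ℝ) →L[ℝ] E => L (Pi.single ν 1)) rfl

lemma ContDiff.box (hg : ContDiff ℝ ∞ g) : ContDiff ℝ ∞ (box g) :=
  ((((hg.pd 0).pd 0).sub ((hg.pd 1).pd 1)).sub ((hg.pd 2).pd 2)).sub ((hg.pd 3).pd 3)

lemma HasCompactSupport.box (hg : HasCompactSupport g) : HasCompactSupport (box g) :=
  ((((hg.pd 0).pd 0).sub ((hg.pd 1).pd 1)).sub ((hg.pd 2).pd 2)).sub ((hg.pd 3).pd 3)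

lemma pd_comm (hg : ContDiff ℝ ∞ g) (μ ν : Fin 4) (x : Fin 4 → ℝ) :
    pd μ (pd ν g) x = pd ν (pd μ g) x := by
  have hd : DifferentiableAt ℝ (fderiv ℝ g) x :=
    (hg.fderiv_right (m := ∞) (by simp)).differentiable (by simp) x
  have h : ∀ μ ν : Fin 4, _root_.pd μ (_root_.pd ν g) x
      = fderiv ℝ (fderiv ℝ g) x (Pi.single μ 1) (Pi.single ν 1) := fun μ ν => by
    rw [_root_.pd, show _root_.pd ν g = fun y => fderiv ℝ g y (Pi.single ν 1) from rfl,
      fderiv_clm_apply hd (differentiableAt_const _)]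
    simp
  rw [h, h]
  exact (hg.contDiffAt.isSymmSndFDerivAt
    (by simpa using WithTop.coe_le_coe.2 (le_top (a := (2 : ℕ∞))))).eq _ _

/-- Chain rule along a line in space, with a time shift depending on the position. -/
lemma hasDerivAt_comp_shift (hg : ContDiff ℝ ∞ g) (p : Fin 4 → ℝ)
    (z : EuclideanSpace ℝ (Fin 3)) (i : Fin 3) {a : ℝ → ℝ} {a' : ℝ} (ha : HasDerivAt a a' 0) :
    HasDerivAt (fun s : ℝ => g (shift p (a s) (z + s • EuclideanSpace.single i 1)))
      (pd i.succ g (shift p (a 0) z) + a' • pd 0 g (shift p (a 0) z)) 0 := by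
  have h1 : HasDerivAt (fun s : ℝ => shift p (a s) (z + s • EuclideanSpace.single i 1))
      (a' • Pi.single 0 1 + Pi.single i.succ 1) 0 := by
    have h2 : HasDerivAt (fun s : ℝ => embed (z + s • EuclideanSpace.single i 1))
        (embed (EuclideanSpace.single i 1)) 0 := by
      have := embed.hasFDerivAt (x := z + (0 : ℝ) • EuclideanSpace.single i 1) |>.comp_hasDerivAt 0
        (((hasDerivAt_id (0 : ℝ)).smul_const (EuclideanSpace.single i (1 : ℝ))).const_add z)
      rw [one_smul] at this
      exact this
    rw [embed_single] at h2
    exact ((ha.smul_const _).const_add p).add h2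
  have h3 := ((hg.differentiable (by simp)) (shift p (a 0) z)).hasFDerivAt.comp_hasDerivAt_of_eq 0
    h1 (by simp)
  convert! h3 using 1
  rw [map_add, map_smul, add_comm]
  rfl

lemma integral_eq_zero_of_hasLineDerivAt {V : Type*} [NormedAddCommGroup V] [NormedSpace ℝ V]
    [FiniteDimensional ℝ V] [MeasurableSpace V] [BorelSpace V] {μ : Measure V}
    [μ.IsAddHaarMeasure] {f f' : V → ℂ} {v : V} (hf : Integrable f μ) (hf' : Integrable f' μ)
    (h : ∀ x, HasLineDerivAt ℝ f (f' x) x v) : ∫ x, f' x ∂μ = 0 := by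
  have := integral_bilinear_hasLineDerivAt_right_eq_neg_left_of_integrable (μ := μ)
    (f := fun _ : V => (1 : ℝ)) (f' := fun _ => 0) (g := f) (g' := f') (v := v)
    (B := ContinuousLinearMap.lsmul ℝ ℝ) (by simp) (by simpa) (by simpa)
    (fun _ _ => hasDerivAt_const _ _) (fun x _ => h x)
  simpa using this

end

/-- The distance `√(|z|² + δ²)`, regularised at the origin. -/
def regDist (δ : ℝ) (z : EuclideanSpace ℝ (Fin 3)) : ℝ := √(‖z‖ ^ 2 + δ ^ 2)

lemma regDist_sq (δ : ℝ) (z : EuclideanSpace ℝ (Fin 3)) :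
    regDist δ z ^ 2 = ‖z‖ ^ 2 + δ ^ 2 := Real.sq_sqrt (by positivity)

lemma regDist_pos {δ : ℝ} (hδ : 0 < δ) (z : EuclideanSpace ℝ (Fin 3)) : 0 < regDist δ z :=
  Real.sqrt_pos.2 (by positivity)

lemma continuous_regDist : Continuous fun q : ℝ × EuclideanSpace ℝ (Fin 3) =>
    regDist q.1 q.2 := by
  unfold regDist; fun_prop

lemma continuous_regDist_right (δ : ℝ) : Continuous (regDist δ) := by
  unfold regDist; fun_prop

lemma norm_le_regDist (δ : ℝ) (z : EuclideanSpace ℝ (Fin 3)) : ‖z‖ ≤ regDist δ z :=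
  Real.le_sqrt_of_sq_le (by nlinarith [sq_nonneg δ])

lemma hasDerivAt_regDist {δ : ℝ} (hδ : 0 < δ) (z : EuclideanSpace ℝ (Fin 3)) (i : Fin 3) :
    HasDerivAt (fun s : ℝ => regDist δ (z + s • EuclideanSpace.single i 1))
      (z i * (regDist δ z)⁻¹) 0 := by
  have h1 : HasDerivAt (fun s : ℝ => z + s • EuclideanSpace.single i (1 : ℝ))
      (EuclideanSpace.single i 1) 0 := by
    simpa using ((hasDerivAt_id (0 : ℝ)).smul_const (EuclideanSpace.single i (1 : ℝ))).const_add z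
  have h2 := (h1.norm_sq.add_const (δ ^ 2)).sqrt (by simp; positivity)
  convert! h2 using 1
  have h0 := (regDist_pos hδ z).ne'
  simp only [zero_smul, add_zero, EuclideanSpace.inner_single_right]
  rw [show √(‖z‖ ^ 2 + δ ^ 2) = regDist δ z from rfl]
  simp
  field_simp

section

variable {g : (Fin 4 → ℝ) → ℂ} {p : Fin 4 → ℝ} {δ : ℝ}

lemma continuous_comp_shift_regDist {f : (Fin 4 → ℝ) → ℂ} (hf : Continuous f) (p : Fin 4 → ℝ)
    (δ : ℝ) : Continuous fun z => f (shift p (-regDist δ z) z) :=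
  hf.comp ((continuous_shift p).comp ((continuous_regDist_right δ).neg.prodMk continuous_id))

lemma hasCompactSupport_comp_shift_regDist {f : (Fin 4 → ℝ) → ℂ} (hf : HasCompactSupport f)
    (p : Fin 4 → ℝ) (δ : ℝ) : HasCompactSupport fun z => f (shift p (-regDist δ z) z) :=
  hasCompactSupport_comp_shift hf p (continuous_regDist_right δ).neg

lemma continuous_regDist_inv (hδ : 0 < δ) : Continuous fun z => (regDist δ z)⁻¹ :=
  (continuous_regDist_right δ).inv₀ fun z => (regDist_pos hδ z).ne'

/-- A retarded integrand with a continuous weight is integrable. -/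
lemma integrable_mul_comp_shift {f : (Fin 4 → ℝ) → ℂ} (hf : Continuous f)
    (hf' : HasCompactSupport f) (p : Fin 4 → ℝ) (δ : ℝ) {w : EuclideanSpace ℝ (Fin 3) → ℝ}
    (hw : Continuous w) :
    Integrable fun z => (w z : ℂ) * f (shift p (-regDist δ z) z) :=
  ((Complex.continuous_ofReal.comp hw).mul
    (continuous_comp_shift_regDist hf p δ)).integrable_of_hasCompactSupport
    (hasCompactSupport_comp_shift_regDist hf' p δ).mul_left

/-- The regularised Kirchhoff formula: the integral of the divergence of the retarded field
vanishes. -/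
lemma integral_box_comp_shift (hg : ContDiff ℝ ∞ g) (hgc : HasCompactSupport g) (p : Fin 4 → ℝ)
    (hδ : 0 < δ) :
    ∫ z, (((regDist δ z)⁻¹ : ℝ) : ℂ) * box g (shift p (-regDist δ z) z) =
      ∫ z, (((3 * δ ^ 2 * (regDist δ z)⁻¹ ^ 5 : ℝ) : ℂ) * g (shift p (-regDist δ z) z)
        + ((δ ^ 2 * (regDist δ z)⁻¹ ^ 3 : ℝ) : ℂ) * pd 0 (pd 0 g) (shift p (-regDist δ z) z)
        + ((3 * δ ^ 2 * (regDist δ z)⁻¹ ^ 4 : ℝ) : ℂ) * pd 0 g (shift p (-regDist δ z) z)) := by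
  set k : EuclideanSpace ℝ (Fin 3) → ℝ := fun z => (regDist δ z)⁻¹ with hk
  have hkc : Continuous k := continuous_regDist_inv hδ
  set R : ((Fin 4 → ℝ) → ℂ) → EuclideanSpace ℝ (Fin 3) → ℂ :=
    fun f z => f (shift p (-regDist δ z) z) with hR
  have hint : ∀ f : (Fin 4 → ℝ) → ℂ, ContDiff ℝ ∞ f → HasCompactSupport f →
      ∀ w : EuclideanSpace ℝ (Fin 3) → ℝ, Continuous w →
      Integrable fun z => (w z : ℂ) * R f z := fun f hf hf' w hw =>
    integrable_mul_comp_shift hf.continuous hf' p δ hw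
  set V : Fin 3 → EuclideanSpace ℝ (Fin 3) → ℂ := fun i z =>
    (k z : ℂ) * R (pd i.succ g) z + ((z i * k z ^ 2 : ℝ) : ℂ) * R (pd 0 g) z
      + ((z i * k z ^ 3 : ℝ) : ℂ) * R g z with hV
  set D : Fin 3 → EuclideanSpace ℝ (Fin 3) → ℂ := fun i z =>
    ((-z i * k z ^ 3 : ℝ) : ℂ) * R (pd i.succ g) z
    + (k z : ℂ) * R (pd i.succ (pd i.succ g)) z
    + ((-z i * k z ^ 2 : ℝ) : ℂ) * R (pd 0 (pd i.succ g)) z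
    + ((k z ^ 2 - 2 * z i ^ 2 * k z ^ 4 : ℝ) : ℂ) * R (pd 0 g) z
    + ((z i * k z ^ 2 : ℝ) : ℂ) * R (pd i.succ (pd 0 g)) z
    + ((-z i ^ 2 * k z ^ 3 : ℝ) : ℂ) * R (pd 0 (pd 0 g)) z
    + ((k z ^ 3 - 3 * z i ^ 2 * k z ^ 5 : ℝ) : ℂ) * R g z
    + ((z i * k z ^ 3 : ℝ) : ℂ) * R (pd i.succ g) z
    + ((-z i ^ 2 * k z ^ 4 : ℝ) : ℂ) * R (pd 0 g) z with hD
  have hVi : ∀ i, Integrable (V i) := fun i =>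
    ((hint _ (hg.pd _) (hgc.pd _) _ hkc).add
      (hint _ (hg.pd _) (hgc.pd _) _ (by fun_prop))).add (hint _ hg hgc _ (by fun_prop))
  have hDi : ∀ i, Integrable (D i) := fun i =>
    ((((((((hint _ (hg.pd _) (hgc.pd _) _ (by fun_prop)).add
      (hint _ ((hg.pd _).pd _) ((hgc.pd _).pd _) _ hkc)).add
      (hint _ ((hg.pd _).pd _) ((hgc.pd _).pd _) _ (by fun_prop))).add
      (hint _ (hg.pd _) (hgc.pd _) _ (by fun_prop))).add
      (hint _ ((hg.pd _).pd _) ((hgc.pd _).pd _) _ (by fun_prop))).add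
      (hint _ ((hg.pd _).pd _) ((hgc.pd _).pd _) _ (by fun_prop))).add
      (hint _ hg hgc _ (by fun_prop))).add
      (hint _ (hg.pd _) (hgc.pd _) _ (by fun_prop))).add
      (hint _ (hg.pd _) (hgc.pd _) _ (by fun_prop))
  have hR' : ∀ f : (Fin 4 → ℝ) → ℂ, ContDiff ℝ ∞ f → ∀ (i : Fin 3) z,
      HasDerivAt (fun s : ℝ => R f (z + s • EuclideanSpace.single i 1))
        (R (pd i.succ f) z - ((z i * k z : ℝ) : ℂ) * R (pd 0 f) z) 0 := by
    intro f hf i z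
    convert! hasDerivAt_comp_shift hf p z i (hasDerivAt_regDist hδ z i).neg using 1
    simp [hR, hk, sub_eq_add_neg]
  have hk' : ∀ (i : Fin 3) z, HasDerivAt
      (fun s : ℝ => ((k (z + s • EuclideanSpace.single i 1) : ℝ) : ℂ))
      ((-z i * k z ^ 3 : ℝ) : ℂ) 0 := by
    intro i z
    have h := ((hasDerivAt_regDist hδ z i).inv (by simpa using (regDist_pos hδ z).ne')).ofReal_comp
    convert! h using 1
    have h0 := (regDist_pos hδ z).ne'
    simp [hk]
    field_simp
  have hz' : ∀ (i : Fin 3) (z : EuclideanSpace ℝ (Fin 3)), HasDerivAt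
      (fun s : ℝ => (((z + s • EuclideanSpace.single i (1 : ℝ)) i : ℝ) : ℂ)) 1 0 := by
    intro i z
    have h := ((hasDerivAt_id (0 : ℝ)).const_add (z i)).ofReal_comp
    simpa using h
  have hVD : ∀ i z, HasLineDerivAt ℝ (V i) (D i z) z (EuclideanSpace.single i 1) := by
    intro i z
    have h1 := (hk' i z).mul (hR' _ (hg.pd i.succ) i z)
    have h2 := ((hz' i z).mul ((hk' i z).pow 2)).mul (hR' _ (hg.pd 0) i z)
    have h3 := ((hz' i z).mul ((hk' i z).pow 3)).mul (hR' _ hg i z)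
    have h := (h1.add h2).add h3
    unfold HasLineDerivAt
    convert! h using 1
    · ext s
      simp [hV]
    · simp [hD]
      ring
  have hzero : ∀ i, ∫ z, D i z = 0 := fun i =>
    integral_eq_zero_of_hasLineDerivAt (hVi i) (hDi i) (hVD i)
  have hsum : ∀ z, D 0 z + D 1 z + D 2 z = (((3 * δ ^ 2 * k z ^ 5 : ℝ) : ℂ) * R g z
        + ((δ ^ 2 * k z ^ 3 : ℝ) : ℂ) * R (pd 0 (pd 0 g)) z
        + ((3 * δ ^ 2 * k z ^ 4 : ℝ) : ℂ) * R (pd 0 g) z) - (k z : ℂ) * R (box g) z := by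
    intro z
    have hk2 : k z ^ 2 * (z 0 ^ 2 + z 1 ^ 2 + z 2 ^ 2 + δ ^ 2) = 1 := by
      have h := regDist_sq δ z
      rw [EuclideanSpace.real_norm_sq_eq, Fin.sum_univ_three] at h
      rw [← h, ← mul_pow, hk, inv_mul_cancel₀ (regDist_pos hδ z).ne', one_pow]
    have hk2' := congrArg (fun x : ℝ => (x : ℂ)) hk2
    push_cast at hk2'
    have hsymm : ∀ i : Fin 3, R (pd i.succ (pd 0 g)) z = R (pd 0 (pd i.succ g)) z :=
      fun i => pd_comm hg _ _ _
    have hbox : R (box g) z = R (pd 0 (pd 0 g)) z - R (pd 1 (pd 1 g)) z - R (pd 2 (pd 2 g)) z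
      - R (pd 3 (pd 3 g)) z := rfl
    rw [hbox]
    simp only [hD, hsymm]
    simp only [Fin.succ_zero_eq_one, Fin.succ_one_eq_two, show (2 : Fin 3).succ = 3 from rfl]
    push_cast
    linear_combination (-(k z : ℂ) * R (pd 0 (pd 0 g)) z - 3 * (k z : ℂ) ^ 2 * R (pd 0 g) z
      - 3 * (k z : ℂ) ^ 3 * R g z) * hk2'
  change ∫ z, (k z : ℂ) * R (box g) z = ∫ z, (((3 * δ ^ 2 * k z ^ 5 : ℝ) : ℂ) * R g z
        + ((δ ^ 2 * k z ^ 3 : ℝ) : ℂ) * R (pd 0 (pd 0 g)) z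
        + ((3 * δ ^ 2 * k z ^ 4 : ℝ) : ℂ) * R (pd 0 g) z)
  rw [eq_comm, ← sub_eq_zero, ← integral_sub _ (hint _ hg.box hgc.box _ hkc)]
  · simp_rw [← hsum]
    have h01 : Integrable fun z => D 0 z + D 1 z := (hDi 0).add (hDi 1)
    rw [integral_add h01 (hDi 2), integral_add (hDi 0) (hDi 1), hzero, hzero,
      hzero, add_zero, add_zero]
  · exact ((hint _ hg hgc _ (by fun_prop)).add
      (hint _ ((hg.pd _).pd _) ((hgc.pd _).pd _) _ (by fun_prop))).add
      (hint _ (hg.pd _) (hgc.pd _) _ (by fun_prop))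

end

lemma regDist_smul {δ : ℝ} (hδ : 0 < δ) (w : EuclideanSpace ℝ (Fin 3)) :
    regDist δ (δ • w) = δ * regDist 1 w := by
  rw [regDist, regDist, norm_smul, Real.norm_of_nonneg hδ.le, ← Real.sqrt_sq hδ.le,
    ← Real.sqrt_mul (sq_nonneg _), Real.sqrt_sq hδ.le]
  ring_nf

lemma one_le_regDist_one (w : EuclideanSpace ℝ (Fin 3)) : 1 ≤ regDist 1 w :=
  Real.le_sqrt_of_sq_le (by nlinarith [sq_nonneg ‖w‖])

lemma integrable_regDist_inv_pow_four :
    Integrable fun w : EuclideanSpace ℝ (Fin 3) => (regDist 1 w)⁻¹ ^ 4 := by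
  have h := integrable_rpow_neg_one_add_norm_sq (E := EuclideanSpace ℝ (Fin 3)) (μ := volume)
    (r := 4) (by simp; norm_num)
  refine h.congr (ae_of_all _ fun w => ?_)
  have h1 : (regDist 1 w) ^ 2 = 1 + ‖w‖ ^ 2 := by rw [regDist_sq]; ring
  simp only
  rw [show (-4 / 2 : ℝ) = -(2 : ℕ) by norm_num, Real.rpow_neg (by positivity), Real.rpow_natCast,
    ← h1, inv_pow, ← pow_mul]

lemma integrable_regDist_inv_pow_five :
    Integrable fun w : EuclideanSpace ℝ (Fin 3) => (regDist 1 w)⁻¹ ^ 5 := by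
  have hc := continuous_regDist_inv one_pos
  refine integrable_regDist_inv_pow_four.mono' (hc.pow 5).aestronglyMeasurable
    (ae_of_all _ fun w => ?_)
  have := one_le_regDist_one w
  rw [Real.norm_of_nonneg (by positivity)]
  exact pow_le_pow_of_le_one (by positivity) (inv_le_one_of_one_le₀ this) (by norm_num)

/-- The normalisation constant (`4π`) in Kirchhoff's formula. -/
def kirchhoffConst : ℝ := ∫ w : EuclideanSpace ℝ (Fin 3), 3 * (regDist 1 w)⁻¹ ^ 5

lemma kirchhoffConst_pos : 0 < kirchhoffConst := by
  have hpos : ∀ w : EuclideanSpace ℝ (Fin 3), 0 < 3 * (regDist 1 w)⁻¹ ^ 5 := fun w => by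
    have := regDist_pos one_pos w
    positivity
  have hc : Continuous fun w : EuclideanSpace ℝ (Fin 3) => 3 * (regDist 1 w)⁻¹ ^ 5 :=
    ((continuous_regDist_inv one_pos).pow 5).const_mul 3
  exact integral_pos_of_integrable_nonneg_nonzero hc (integrable_regDist_inv_pow_five.const_mul 3)
    (fun w => (hpos w).le) (hpos 0).ne'

lemma exists_bound_time {E : Type*} [NormedAddCommGroup E] {f : (Fin 4 → ℝ) → E}
    (hf : HasCompactSupport f) : ∃ C : ℝ, 0 ≤ C ∧ ∀ q, f q ≠ 0 → |q 0| ≤ C := by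
  obtain ⟨C, hC⟩ := hf.isCompact.exists_bound_of_continuousOn
    (f := fun q : Fin 4 → ℝ => q 0) (by fun_prop)
  exact ⟨max C 0, le_max_right _ _, fun q hq =>
    (hC q (subset_tsupport _ hq)).trans (le_max_left _ _)⟩

/-- Kirchhoff's formula for the retarded solution, as a limit of regularised integrals. -/
lemma tendsto_integral_box {g : (Fin 4 → ℝ) → ℂ} (hg : ContDiff ℝ ∞ g) (hgc : HasCompactSupport g)
    (p : Fin 4 → ℝ) :
    Tendsto (fun δ => ∫ z, (((regDist δ z)⁻¹ : ℝ) : ℂ) * box g (shift p (-regDist δ z) z))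
      (𝓝[>] 0) (𝓝 (kirchhoffConst * g p)) := by
  set j : EuclideanSpace ℝ (Fin 3) → ℝ := fun w => (regDist 1 w)⁻¹ with hj
  have hjc : Continuous j := continuous_regDist_inv one_pos
  have hj0 : ∀ w, 0 < j w := fun w => inv_pos.2 (regDist_pos one_pos w)
  have hj1 : ∀ w, j w ≤ 1 := fun w => inv_le_one_of_one_le₀ (one_le_regDist_one w)
  set q : ℝ → EuclideanSpace ℝ (Fin 3) → Fin 4 → ℝ :=
    fun δ w => shift p (-(δ * regDist 1 w)) (δ • w) with hq
  have hqc : ∀ δ, Continuous (q δ) := fun δ => by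
    have := continuous_regDist_right 1
    exact (continuous_shift p).comp (Continuous.prodMk (by fun_prop) (by fun_prop))
  set F : ℝ → EuclideanSpace ℝ (Fin 3) → ℂ := fun δ w =>
    ((3 * j w ^ 5 : ℝ) : ℂ) * g (q δ w) + ((δ ^ 2 * j w ^ 3 : ℝ) : ℂ) * pd 0 (pd 0 g) (q δ w)
      + ((3 * δ * j w ^ 4 : ℝ) : ℂ) * pd 0 g (q δ w) with hF
  have hscale : ∀ δ : ℝ, 0 < δ →
      ∫ z, (((regDist δ z)⁻¹ : ℝ) : ℂ) * box g (shift p (-regDist δ z) z) = ∫ w, F δ w := by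
    intro δ hδ
    rw [integral_box_comp_shift hg hgc p hδ]
    set f : EuclideanSpace ℝ (Fin 3) → ℂ := fun z =>
      ((3 * δ ^ 2 * (regDist δ z)⁻¹ ^ 5 : ℝ) : ℂ) * g (shift p (-regDist δ z) z)
        + ((δ ^ 2 * (regDist δ z)⁻¹ ^ 3 : ℝ) : ℂ) * pd 0 (pd 0 g) (shift p (-regDist δ z) z)
        + ((3 * δ ^ 2 * (regDist δ z)⁻¹ ^ 4 : ℝ) : ℂ) * pd 0 g (shift p (-regDist δ z) z) with hf
    have h1 := Measure.integral_comp_smul_of_nonneg volume f δ (hR := hδ.le)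
    rw [finrank_euclideanSpace_fin, eq_inv_smul_iff₀ (by positivity)] at h1
    rw [← h1, ← integral_smul]
    congr 1
    ext w
    have hδ' : (δ : ℂ) ≠ 0 := by exact_mod_cast hδ.ne'
    simp only [hf, hF, hq, hj, regDist_smul hδ, mul_inv, Complex.real_smul]
    push_cast
    field_simp
  obtain ⟨M₀, hM₀⟩ := hg.continuous.bounded_above_of_compact_support hgc
  obtain ⟨M₁, hM₁⟩ := (hg.pd 0).continuous.bounded_above_of_compact_support (hgc.pd 0)
  obtain ⟨M₂, hM₂⟩ :=
    ((hg.pd 0).pd 0).continuous.bounded_above_of_compact_support ((hgc.pd 0).pd 0)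
  obtain ⟨C, hC0, hC⟩ := exists_bound_time ((hgc.pd 0).pd 0)
  have hlim : Tendsto (fun δ => ∫ w, F δ w) (𝓝[>] 0)
      (𝓝 (∫ w, ((3 * j w ^ 5 : ℝ) : ℂ) * g p)) := by
    refine tendsto_integral_filter_of_dominated_convergence
      (fun w => (3 * M₀ + (C + |p 0|) * M₂ + 3 * M₁) * j w ^ 4) ?_ ?_
      (integrable_regDist_inv_pow_four.const_mul _) ?_
    · refine Eventually.of_forall fun δ => Continuous.aestronglyMeasurable ?_
      have h0 := hg.continuous.comp (hqc δ)
      have h1 := (hg.pd 0).continuous.comp (hqc δ)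
      have h2 := ((hg.pd 0).pd 0).continuous.comp (hqc δ)
      refine ((Complex.continuous_ofReal.comp (by fun_prop)).mul h0).add
        ((Complex.continuous_ofReal.comp (by fun_prop)).mul h2) |>.add
        ((Complex.continuous_ofReal.comp (by fun_prop)).mul h1)
    · filter_upwards [Ioo_mem_nhdsGT (zero_lt_one (α := ℝ))] with δ hδ
      refine ae_of_all _ fun w => ?_
      have hδ0 := hδ.1
      have hδ1 := hδ.2
      have hjw := hj0 w
      have hjw1 := hj1 w
      have hM1 : 0 ≤ M₁ := (norm_nonneg _).trans (hM₁ 0)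
      have hM2 : 0 ≤ M₂ := (norm_nonneg _).trans (hM₂ 0)
      have b0 : ‖((3 * j w ^ 5 : ℝ) : ℂ) * g (q δ w)‖ ≤ 3 * M₀ * j w ^ 4 := by
        rw [norm_mul, Complex.norm_real, Real.norm_of_nonneg (by positivity)]
        calc 3 * j w ^ 5 * ‖g (q δ w)‖ ≤ 3 * j w ^ 4 * M₀ := by
              gcongr ?_ * ?_
              · gcongr 3 * ?_
                exact pow_le_pow_of_le_one hjw.le hjw1 (by norm_num)
              · exact hM₀ _
          _ = _ := by ring
      have b1 : ‖((3 * δ * j w ^ 4 : ℝ) : ℂ) * pd 0 g (q δ w)‖ ≤ 3 * M₁ * j w ^ 4 := by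
        rw [norm_mul, Complex.norm_real, Real.norm_of_nonneg (by positivity)]
        calc 3 * δ * j w ^ 4 * ‖pd 0 g (q δ w)‖ ≤ 3 * 1 * j w ^ 4 * M₁ := by
              gcongr
              exact hM₁ _
          _ = _ := by ring
      have b2 : ‖((δ ^ 2 * j w ^ 3 : ℝ) : ℂ) * pd 0 (pd 0 g) (q δ w)‖
          ≤ (C + |p 0|) * M₂ * j w ^ 4 := by
        rw [norm_mul, Complex.norm_real, Real.norm_of_nonneg (by positivity)]
        rcases eq_or_ne (pd 0 (pd 0 g) (q δ w)) 0 with h0 | h0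
        · rw [h0, norm_zero, mul_zero]
          positivity
        · have h1 : δ * regDist 1 w ≤ C + |p 0| := by
            have h2 := hC _ h0
            simp only [hq, shift_zero_apply] at h2
            have h3 := neg_le_abs (p 0 + -(δ * regDist 1 w))
            have h4 := le_abs_self (p 0)
            linarith
          have h2 : regDist 1 w * j w = 1 := mul_inv_cancel₀ (regDist_pos one_pos w).ne'
          calc δ ^ 2 * j w ^ 3 * ‖pd 0 (pd 0 g) (q δ w)‖
              = (δ * regDist 1 w) * δ * (j w ^ 4 * ‖pd 0 (pd 0 g) (q δ w)‖) := by
                linear_combination (-δ ^ 2 * j w ^ 3 * ‖pd 0 (pd 0 g) (q δ w)‖) * h2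
            _ ≤ (C + |p 0|) * 1 * (j w ^ 4 * M₂) := by
                have := regDist_pos one_pos w
                have h5 : 0 ≤ C + |p 0| := le_trans (by positivity) h1
                gcongr
                exact hM₂ _
            _ = _ := by ring
      calc ‖F δ w‖ ≤ _ := norm_add₃_le
        _ ≤ 3 * M₀ * j w ^ 4 + (C + |p 0|) * M₂ * j w ^ 4 + 3 * M₁ * j w ^ 4 := by gcongr
        _ = _ := by ring
    · refine ae_of_all _ fun w => ?_
      have hcont : Continuous fun δ => F δ w := by
        have hq' : Continuous fun δ => q δ w :=
          (continuous_shift p).comp (Continuous.prodMk (by fun_prop) (by fun_prop))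
        have h0 := hg.continuous.comp hq'
        have h1 := (hg.pd 0).continuous.comp hq'
        have h2 := ((hg.pd 0).pd 0).continuous.comp hq'
        refine ((Complex.continuous_ofReal.comp (by fun_prop)).mul h0).add
          ((Complex.continuous_ofReal.comp (by fun_prop)).mul h2) |>.add
          ((Complex.continuous_ofReal.comp (by fun_prop)).mul h1)
      have hq0 : q 0 w = p := by simp [hq, shift]
      have := hcont.tendsto' 0 (((3 * j w ^ 5 : ℝ) : ℂ) * g p) (by simp [hF, hq0])
      exact this.mono_left nhdsWithin_le_nhds
  rw [integral_mul_const, integral_complex_ofReal] at hlim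
  exact hlim.congr' (by filter_upwards [self_mem_nhdsWithin] with δ hδ using (hscale δ hδ).symm)

lemma shift_eq_shift_zero (p : Fin 4 → ℝ) (s : ℝ) (z : EuclideanSpace ℝ (Fin 3)) :
    shift p s z = shift 0 (p 0 + s) (spatial p + z) := by
  ext i
  refine Fin.cases ?_ (fun j => ?_) i <;> simp [shift]

@[simp] lemma regDist_zero (z : EuclideanSpace ℝ (Fin 3)) : regDist 0 z = ‖z‖ := by
  simp [regDist]

lemma integral_pd_zero_comp_shift {h : (Fin 4 → ℝ) → ℂ} (hh : ContDiff ℝ ∞ h) (p : Fin 4 → ℝ)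
    {r : ℝ} (hr : r ≠ 0) (z : EuclideanSpace ℝ (Fin 3)) :
    ∫ l in (-1 : ℝ)..1, pd 0 h (shift p (l * r) z) =
      ((r⁻¹ : ℝ) : ℂ) * (h (shift p r z) - h (shift p (-r) z)) := by
  have hd : ∀ l : ℝ, HasDerivAt (fun l : ℝ => h (shift p (l * r) z))
      (r • pd 0 h (shift p (l * r) z)) l := by
    intro l
    have h1 : HasDerivAt (fun l : ℝ => shift p (l * r) z) (r • Pi.single 0 1) l := by
      simpa [shift] using
        ((((hasDerivAt_id l).mul_const r).smul_const (Pi.single (0 : Fin 4) (1 : ℝ))).const_add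
          p).add_const (embed z)
    have h2 := ((hh.differentiable (by simp)) (shift p (l * r) z)).hasFDerivAt.comp_hasDerivAt l h1
    rw [map_smul] at h2
    exact h2
  have hc : Continuous fun l : ℝ => r • pd 0 h (shift p (l * r) z) :=
    ((hh.pd 0).continuous.comp ((continuous_shift p).comp
      (Continuous.prodMk (by fun_prop) continuous_const))).const_smul r
  have := intervalIntegral.integral_eq_sub_of_hasDerivAt (a := -1) (b := 1) (fun l _ => hd l)
    (hc.intervalIntegrable _ _)
  rw [intervalIntegral.integral_smul, one_mul, neg_one_mul] at this
  rw [← this, ← Complex.real_smul, inv_smul_smul₀ hr]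

/-- Kirchhoff's formula, written as a superposition of spherical waves, when the source `□g` can
be replaced on the past cone of `p` by a source `h` vanishing on the future cone of `p`. -/
lemma kirchhoff_superposition {g h : (Fin 4 → ℝ) → ℂ} (hg : ContDiff ℝ ∞ g)
    (hgc : HasCompactSupport g) (hh : ContDiff ℝ ∞ h) (hhc : HasCompactSupport h)
    (p : Fin 4 → ℝ)
    (hret : ∀ s z, ‖z‖ ≤ s → box g (shift p (-s) z) = h (shift p (-s) z))
    (hadv : ∀ s z, ‖z‖ ≤ s → h (shift p s z) = 0) :
    kirchhoffConst * g p = -∫ y, sphWave (fun s => pd 0 h (shift 0 s y)) y p := by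
  set A : ℝ → EuclideanSpace ℝ (Fin 3) → ℂ := fun δ z =>
    ∫ l in (-1 : ℝ)..1, pd 0 h (shift p (l * regDist δ z) z) with hA
  have hAc : Continuous (Function.uncurry A) := by
    apply intervalIntegral.continuous_parametric_intervalIntegral_of_continuous'
    refine (hh.pd 0).continuous.comp ((continuous_shift p).comp
      (Continuous.prodMk (continuous_snd.mul (continuous_regDist.comp continuous_fst)) ?_))
    fun_prop
  set S : Set (EuclideanSpace ℝ (Fin 3)) :=
    (fun q => spatial q - spatial p) '' tsupport (pd 0 h) with hS
  have hSc : IsCompact S := (hhc.pd 0).isCompact.image (by fun_prop)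
  have hAS : ∀ δ, ∀ z ∉ S, A δ z = 0 := by
    intro δ z hz
    rw [hA]
    have : ∀ s, pd 0 h (shift p s z) = 0 := fun s => by
      by_contra hne
      exact hz ⟨_, subset_tsupport _ hne, by simp⟩
    simp [this]
  have h1 : Tendsto (fun δ => ∫ z, A δ z) (𝓝[>] 0) (𝓝 (∫ z, A 0 z)) := by
    have hset : ∀ δ, ∫ z, A δ z = ∫ z in S, A δ z := fun δ =>
      (setIntegral_eq_integral_of_forall_compl_eq_zero (hAS δ)).symm
    simp only [hset]
    have := (continuous_parametric_integral_of_continuous (μ := volume) hAc hSc).tendsto 0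
    exact this.mono_left nhdsWithin_le_nhds
  have h2 : Tendsto (fun δ => ∫ z, A δ z) (𝓝[>] 0) (𝓝 (-(kirchhoffConst * g p))) := by
    refine (tendsto_integral_box hg hgc p).neg.congr' ?_
    filter_upwards [self_mem_nhdsWithin] with δ (hδ : 0 < δ)
    rw [← integral_neg]
    congr 1
    ext z
    have hz := norm_le_regDist δ z
    rw [hA, hret _ _ hz]
    simp only
    rw [integral_pd_zero_comp_shift hh p (regDist_pos hδ z).ne', hadv _ _ hz, zero_sub, mul_neg]
  rw [eq_neg_iff_add_eq_zero, ← neg_eq_iff_add_eq_zero, tendsto_nhds_unique h2 h1,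
    ← integral_add_left_eq_self
      (fun y => sphWave (fun s => pd 0 h (shift 0 s y)) y p) (spatial p)]
  congr 1
  ext z
  simp [hA, sphWave, shift_eq_shift_zero p]

lemma AnnihilatesEven.integral_sphWave {B : Set (Fin 4 → ℝ)} [CompactSpace B]
    {L : C(B, ℂ) →L[ℂ] ℂ} (hL : AnnihilatesEven L) (hB : B ⊆ Vplus) {ψ : (Fin 4 → ℝ) → ℂ}
    (hψ : Continuous ψ) (hψc : HasCompactSupport ψ) (F : C(B, ℂ))
    (hF : ∀ β : B, F β = ∫ y, _root_.sphWave (fun s => ψ (shift 0 s y)) y β) : L F = 0 := by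
  have hprof : ∀ y, Continuous fun s => ψ (shift 0 s y) := fun y =>
    hψ.comp ((continuous_shift 0).comp (continuous_id.prodMk continuous_const))
  have hjoint : Continuous fun q : EuclideanSpace ℝ (Fin 3) × B =>
      _root_.sphWave (fun s => ψ (shift 0 s q.1)) q.1 q.2 := by
    suffices h : Continuous fun q : EuclideanSpace ℝ (Fin 3) × (Fin 4 → ℝ) =>
        _root_.sphWave (fun s => ψ (shift 0 s q.1)) q.1 q.2 from
      h.comp (continuous_fst.prodMk (continuous_subtype_val.comp continuous_snd))
    unfold _root_.sphWave
    apply intervalIntegral.continuous_parametric_intervalIntegral_of_continuous'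
    refine hψ.comp ((continuous_shift 0).comp (Continuous.prodMk ?_ (by fun_prop)))
    fun_prop
  set Φ : C(EuclideanSpace ℝ (Fin 3), C(B, ℂ)) := ContinuousMap.curry ⟨_, hjoint⟩ with hΦ
  have hΦc : HasCompactSupport Φ := by
    refine HasCompactSupport.intro (hψc.isCompact.image spatial.continuous) fun y hy => ?_
    have : ∀ s, ψ (shift 0 s y) = 0 := fun s => by
      by_contra hne
      exact hy ⟨_, subset_tsupport _ hne, by simp⟩
    ext β
    simp [hΦ, _root_.sphWave, this]
  have hΦi : Integrable Φ := Φ.continuous.integrable_of_hasCompactSupport hΦc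
  have hFΦ : F = ∫ y, Φ y := by
    ext β
    rw [hF, ContinuousMap.integral_apply hΦi]
    rfl
  rw [hFΦ, ← L.integral_comp_comm hΦi]
  have hLΦ : ∀ y, L (Φ y) = 0 := fun y => hL.sphWave hB y (hprof y)
  simp [hLΦ]


/-- The closed forward light cone. -/
def closedCone : Set (Fin 4 → ℝ) := {v | ‖spatial v‖ ≤ v 0}

lemma isClosed_closedCone : IsClosed closedCone :=
  isClosed_le (by fun_prop) (by fun_prop)

lemma shift_eq_add (p : Fin 4 → ℝ) (s : ℝ) (z : EuclideanSpace ℝ (Fin 3)) :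
    shift p s z = p + shift 0 s z := by simp [shift, add_assoc]

lemma shift_neg_eq_sub (p : Fin 4 → ℝ) (s : ℝ) (z : EuclideanSpace ℝ (Fin 3)) :
    shift p (-s) z = p - shift 0 s (-z) := by
  simp only [shift, map_neg, neg_smul, zero_add]; abel

lemma shift_mem_closedCone {s : ℝ} {z : EuclideanSpace ℝ (Fin 3)} (h : ‖z‖ ≤ s) :
    shift 0 s z ∈ closedCone := by simpa [closedCone] using h

lemma zero_mem_closedCone : (0 : Fin 4 → ℝ) ∈ closedCone := by simp [closedCone]

lemma add_closedCone_subset {B : Set (Fin 4 → ℝ)} (hB : B ⊆ Vplus) : B + closedCone ⊆ Vplus := by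
  rintro _ ⟨b, hb, c, hc, rfl⟩
  have hb := (mem_Vplus_iff b).1 (hB hb)
  have hc : ‖spatial c‖ ≤ c 0 := hc
  rw [mem_Vplus_iff]
  simp only [map_add, Pi.add_apply]
  linarith [norm_add_le (spatial b) (spatial c)]

lemma norm_le_of_mem_closedCone {v : Fin 4 → ℝ} (hv : v ∈ closedCone) : ‖v‖ ≤ v 0 := by
  have hv : ‖spatial v‖ ≤ v 0 := hv
  have h0 : 0 ≤ v 0 := (norm_nonneg _).trans hv
  refine (pi_norm_le_iff_of_nonneg h0).2 (Fin.cases ?_ fun i => ?_)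
  · rw [Real.norm_of_nonneg h0]
  · exact (PiLp.norm_apply_le (spatial v) i).trans hv

lemma isCompact_diamond {B : Set (Fin 4 → ℝ)} (hB : IsCompact B) :
    IsCompact ((B + closedCone) ∩ (B - closedCone)) := by
  have hcl : IsClosed ((B + closedCone) ∩ (B - closedCone)) := by
    refine (isClosed_closedCone.add_left_of_isCompact hB).inter ?_
    rw [sub_eq_add_neg]
    exact isClosed_closedCone.neg.add_left_of_isCompact hB
  obtain ⟨M, hM⟩ := hB.isBounded.exists_norm_le
  refine (hB.add (isCompact_closedBall (0 : Fin 4 → ℝ) (2 * M))).of_isClosed_subset hcl ?_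
  rintro _ ⟨⟨b, hb, c, hc, rfl⟩, b', hb', c', hc', h⟩
  refine ⟨b, hb, c, ?_, rfl⟩
  rw [mem_closedBall_zero_iff]
  refine (norm_le_of_mem_closedCone hc).trans ?_
  have h0 := congrFun h 0
  simp only [Pi.sub_apply, Pi.add_apply] at h0
  have hc0 : 0 ≤ c' 0 := (norm_nonneg _).trans hc'
  have h1 := (norm_le_pi_norm b 0).trans (hM b hb)
  have h2 := (norm_le_pi_norm b' 0).trans (hM b' hb')
  rw [Real.norm_eq_abs] at h1 h2
  linarith [(abs_le.1 h1).1, (abs_le.1 h2).2]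

lemma box_congr_of_eventuallyEq {E : Type*} [NormedAddCommGroup E] [NormedSpace ℝ E]
    {f g : (Fin 4 → ℝ) → E} {x : Fin 4 → ℝ} (h : f =ᶠ[𝓝 x] g) : box f x = box g x := by
  have hpd : ∀ {f g : (Fin 4 → ℝ) → E} (ν : Fin 4), f =ᶠ[𝓝 x] g → pd ν f =ᶠ[𝓝 x] pd ν g :=
    fun ν h => h.fderiv.mono fun y hy => by rw [pd, hy, pd]
  simp only [box, fun ν => (hpd ν (hpd ν h)).eq_of_nhds]

/-- A smooth solution on the forward cone can be cut off to a compactly supported function which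
still solves the wave equation near a given compact set. -/
lemma exists_cutoff {Ξ : (Fin 4 → ℝ) → ℂ} (hΞ : ContDiffOn ℝ ∞ Ξ Vplus)
    (hwave : ∀ β ∈ Vplus, box Ξ β = 0) {K : Set (Fin 4 → ℝ)} (hK : IsCompact K)
    (hKV : K ⊆ Vplus) :
    ∃ g : (Fin 4 → ℝ) → ℂ, ContDiff ℝ ∞ g ∧ HasCompactSupport g ∧ EqOn g Ξ K ∧
      ∀ᶠ x in 𝓝ˢ K, box g x = 0 := by
  obtain ⟨t, htc, hKt, htV⟩ := exists_compact_between hK isOpen_Vplus hKV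
  obtain ⟨χ, hχ1, hχ0, -⟩ := exists_contMDiffMap_one_nhds_of_subset_interior (n := ⊤)
    (modelWithCornersSelf ℝ (Fin 4 → ℝ)) hK.isClosed hKt
  have hχs : ContDiff ℝ ∞ χ := χ.contMDiff.contDiff
  have hg1 : ∀ᶠ x in 𝓝ˢ K, χ x • Ξ x = Ξ x := hχ1.mono fun x hx => by rw [hx, one_smul]
  refine ⟨fun x => χ x • Ξ x, ?_, ?_, fun x hx => hg1.self_of_nhdsSet x hx, ?_⟩
  · rw [contDiff_iff_contDiffAt]
    intro x
    by_cases hx : x ∈ t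
    · exact hχs.contDiffAt.smul (hΞ.contDiffAt (isOpen_Vplus.mem_nhds (htV hx)))
    · refine (contDiffAt_const (c := (0 : ℂ))).congr_of_eventuallyEq ?_
      filter_upwards [htc.isClosed.isOpen_compl.mem_nhds hx] with y hy
      rw [hχ0 y hy, zero_smul]
  · exact HasCompactSupport.intro htc fun x hx => by rw [hχ0 x hx, zero_smul]
  · filter_upwards [hg1.eventually_nhdsSet, isOpen_Vplus.mem_nhdsSet.2 hKV]
      with x hx hxV
    rw [box_congr_of_eventuallyEq hx, hwave x hxV]

/-- A smooth function vanishing near the intersection of two closed sets can be modified to vanish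
on one of them without changing it on the other. -/
lemma exists_contDiff_eqOn_and_eqOn_zero {f : (Fin 4 → ℝ) → ℂ} (hf : ContDiff ℝ ∞ f)
    (hfc : HasCompactSupport f) {P Q : Set (Fin 4 → ℝ)} (hP : IsClosed P) (hQ : IsClosed Q)
    (h : ∀ᶠ x in 𝓝ˢ (P ∩ Q), f x = 0) :
    ∃ g : (Fin 4 → ℝ) → ℂ, ContDiff ℝ ∞ g ∧ HasCompactSupport g ∧ EqOn f g P ∧ EqOn g 0 Q := by
  have hT : ∀ x ∈ P ∩ Q, x ∉ tsupport f := fun x hx =>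
    notMem_tsupport_iff_eventuallyEq.2 (eventually_nhdsSet_iff_forall.1 h x hx)
  obtain ⟨ψ, hψ0, hψ1, -⟩ := exists_contMDiffMap_zero_one_of_isClosed (n := ⊤)
    (modelWithCornersSelf ℝ (Fin 4 → ℝ)) ((isClosed_tsupport f).inter hQ)
    ((isClosed_tsupport f).inter hP)
    (disjoint_left.2 fun x hx hx' => hT x ⟨hx'.2, hx.2⟩ hx.1)
  have hz : ∀ x ∉ tsupport f, f x = 0 := fun x hx => image_eq_zero_of_notMem_tsupport hx
  have hψs : ContDiff ℝ ∞ ψ := ψ.contMDiff.contDiff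
  refine ⟨fun x => ψ x • f x, hψs.smul hf, hfc.smul_left (f := ψ), fun x hx => ?_, fun x hx => ?_⟩
  · by_cases hxT : x ∈ tsupport f
    · simp [hψ1 ⟨hxT, hx⟩]
    · simp [hz x hxT]
  · by_cases hxT : x ∈ tsupport f
    · simp [hψ0 ⟨hxT, hx⟩]
    · simp [hz x hxT]

lemma AnnihilatesEven.solution {B : Set (Fin 4 → ℝ)} [CompactSpace B]
    {L : C(B, ℂ) →L[ℂ] ℂ} (hL : AnnihilatesEven L) (hB : B ⊆ Vplus)
    {Ξ : (Fin 4 → ℝ) → ℂ} (hΞ : ContDiffOn ℝ ∞ Ξ Vplus) (hwave : ∀ β ∈ Vplus, box Ξ β = 0)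
    (F : C(B, ℂ)) (hF : ∀ β : B, F β = Ξ β) : L F = 0 := by
  have hBc : IsCompact B := isCompact_iff_compactSpace.2 ‹_›
  obtain ⟨g, hg, hgc, hgΞ, hbox⟩ := exists_cutoff hΞ hwave (isCompact_diamond hBc)
    (inter_subset_left.trans (add_closedCone_subset hB))
  rw [inter_comm] at hbox
  obtain ⟨h, hh, hhc, hret, hadv⟩ := exists_contDiff_eqOn_and_eqOn_zero hg.box hgc.box
    (by rw [sub_eq_add_neg]; exact isClosed_closedCone.neg.add_left_of_isCompact hBc)
    (isClosed_closedCone.add_left_of_isCompact hBc) hbox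
  have hkey := hL.integral_sphWave hB (hh.pd 0).continuous (hhc.pd 0)
    (-(kirchhoffConst : ℂ) • F) fun β => by
      have hβ : (β : Fin 4 → ℝ) ∈ (B + closedCone) ∩ (B - closedCone) :=
        ⟨⟨β, β.2, 0, zero_mem_closedCone, add_zero _⟩, ⟨β, β.2, 0, zero_mem_closedCone, sub_zero _⟩⟩
      have := kirchhoff_superposition hg hgc hh hhc β
        (fun s z hz => hret (by
          rw [shift_neg_eq_sub]
          exact sub_mem_sub β.2 (shift_mem_closedCone (by rwa [norm_neg]))))
        (fun s z hz => hadv (by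
          rw [shift_eq_add]
          exact add_mem_add β.2 (shift_mem_closedCone hz)))
      rw [ContinuousMap.smul_apply, smul_eq_mul, hF, ← hgΞ hβ, neg_mul, this, neg_neg]
  rw [map_smul, smul_eq_mul, mul_eq_zero] at hkey
  refine hkey.resolve_left ?_
  simpa using kirchhoffConst_pos.ne'

/-- The span of the restrictions to `B` of the even-order derivatives of `invSq`. -/
def evenSpan (B : Set (Fin 4 → ℝ)) : Submodule ℂ C(B, ℂ) :=
  Submodule.span ℂ {F | ∃ μ : List (Fin 4), Even μ.length ∧
    ∀ β : B, F β = (pdIter μ invSq β : ℝ)}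

lemma mem_closure_evenSpan {B : Set (Fin 4 → ℝ)} [CompactSpace B] (hB : B ⊆ Vplus)
    {Ξ : (Fin 4 → ℝ) → ℂ} (hΞ : ContDiffOn ℝ ∞ Ξ Vplus) (hwave : ∀ β ∈ Vplus, box Ξ β = 0)
    (F : C(B, ℂ)) (hF : ∀ β : B, F β = Ξ β) : F ∈ closure (evenSpan B : Set C(B, ℂ)) := by
  by_contra hmem
  set S := (evenSpan B).topologicalClosure with hS
  have : IsClosed (S : Set C(B, ℂ)) := (evenSpan B).isClosed_topologicalClosure
  have hne : S.mkQL F ≠ 0 := by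
    rw [Submodule.coe_mkQL, Submodule.mkQ_apply, Ne, Submodule.Quotient.mk_eq_zero]
    exact hmem
  obtain ⟨f, hf⟩ := SeparatingDual.exists_ne_zero (R := ℂ) hne
  have hL : AnnihilatesEven (f.comp S.mkQL) := fun μ hμ G hG => by
    have hGS : G ∈ S := (evenSpan B).le_topologicalClosure (Submodule.subset_span ⟨μ, hμ, hG⟩)
    rw [ContinuousLinearMap.comp_apply, Submodule.coe_mkQL, Submodule.mkQ_apply,
      (Submodule.Quotient.mk_eq_zero S).2 hGS, map_zero]
  exact hf (hL.solution hB hΞ hwave F hF)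

lemma exists_sum_of_mem_evenSpan {B : Set (Fin 4 → ℝ)} {G : C(B, ℂ)} (hG : G ∈ evenSpan B) :
    ∃ (N : ℕ) (μ : Fin N → List (Fin 4)) (c : Fin N → ℂ), (∀ j, Even (μ j).length) ∧
      ∀ β : B, G β = ∑ j, c j * ((pdIter (μ j) invSq β : ℝ) : ℂ) := by
  obtain ⟨N, c, F, rfl⟩ := Submodule.mem_span_set'.1 hG
  choose μ hμ hF using fun j => (F j).2
  exact ⟨N, μ, c, hμ, fun β => by simp [ContinuousMap.sum_apply, hF]⟩

end

/-- First half of Lemma 3.1: the linear span of the iterated partial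
derivatives of even order of β ↦ (β·β)⁻¹ (the thermal functions of the
balanced derivatives of the Wick square) is dense, with respect to uniform
convergence on compact subsets of V₊, in the smooth solutions of the wave
equation on V₊. -/
theorem even_balanced_thermal_functions_dense
    (Ξ : (Fin 4 → ℝ) → ℂ) (hΞ : ContDiffOn ℝ (⊤ : ℕ∞) Ξ Vplus)
    (hwave : ∀ β ∈ Vplus, box Ξ β = 0)
    (B : Set (Fin 4 → ℝ)) (hB : IsCompact B) (hBV : B ⊆ Vplus)
    (ε : ℝ) (hε : 0 < ε) :
    ∃ (N : ℕ) (μ : Fin N → List (Fin 4)) (c : Fin N → ℂ),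
      (∀ j, Even (μ j).length) ∧
      (⨆ β : B, ‖Ξ (β : Fin 4 → ℝ)
        - ∑ j, c j *
            ((pdIter (μ j) (fun β' => (mink β' β')⁻¹) (β : Fin 4 → ℝ) : ℝ) : ℂ)‖)
        < ε := by
  have : CompactSpace B := isCompact_iff_compactSpace.1 hB
  set F : C(B, ℂ) := ⟨fun β => Ξ β, (hΞ.continuousOn.mono hBV).domRestrict⟩
  obtain ⟨G, hG, hdist⟩ := Metric.mem_closure_iff.1
    (mem_closure_evenSpan hBV hΞ hwave F fun _ => rfl) (ε / 2) (half_pos hε)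
  obtain ⟨N, μ, c, hμ, hGsum⟩ := exists_sum_of_mem_evenSpan hG
  refine ⟨N, μ, c, hμ, (Real.iSup_le (fun β => ?_) (half_pos hε).le).trans_lt (half_lt_self hε)⟩
  have h := (ContinuousMap.dist_apply_le_dist (f := F) (g := G) β).trans hdist.le
  rw [dist_eq_norm, hGsum] at h
  exact h
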